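/- Let L and M be even lattices and let II_{1,1} denote the even unimodular lattice ℤ² with Gram matrix [[0,1],[1,0]]. Then L and M lie in the same genus if and only if the orthogonal direct sums L ⊕ II_{1,1} and M ⊕ II_{1,1} are isometric. -/

import Mathlib

open scoped BigOperators

noncomputable section

/-- The group `ℚ/ℤ`. -/
abbrev QmodZ : Type := ℚ ⧸ AddSubgroup.zmultiples (1 : ℚ)

/-- The group `ℚ/2ℤ`. -/
abbrev Qmod2Z : Type := ℚ ⧸ AddSubgroup.zmultiples (2 : ℚ)

/-- The isomorphism `ℚ/2ℤ → ℚ/ℤ` induced by dividing by `2`. -/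
noncomputable def halfHom : Qmod2Z →+ QmodZ :=
  QuotientAddGroup.map _ _ (AddMonoidHom.mk' (fun x : ℚ => x / 2) (fun a b => add_div a b 2))
    (by
      intro x hx
      obtain ⟨k, rfl⟩ := AddSubgroup.mem_zmultiples_iff.mp hx
      refine AddSubgroup.mem_zmultiples_iff.mpr ⟨k, ?_⟩
      show k • (1:ℚ) = (k • (2:ℚ)) / 2
      push_cast [zsmul_eq_mul]
      ring)

/-- The bilinear form `b(x,y) = (q(x+y) - q(x) - q(y))/2 ∈ ℚ/ℤ` associated to
`q : A → ℚ/2ℤ`. -/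
def bForm {A : Type*} [AddCommGroup A] (q : A → Qmod2Z) (x y : A) : QmodZ :=
  halfHom (q (x + y) - q x - q y)

/-- `q : A → ℚ/2ℤ` is a finite quadratic space structure on the finite abelian group `A`
if the associated form `b` is `ℤ`-bilinear (i.e. biadditive) and nondegenerate. -/
structure IsFiniteQuadraticSpace {A : Type*} [AddCommGroup A] [Finite A]
    (q : A → Qmod2Z) : Prop where
  add_left : ∀ x x' y, bForm q (x + x') y = bForm q x y + bForm q x' y
  add_right : ∀ x y y', bForm q x (y + y') = bForm q x y + bForm q x y'
  nondeg : ∀ x, (∀ y, bForm q x y = 0) → x = 0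

/-- Two quadratic forms are isometric if some group isomorphism carries one to the other. -/
def FQSIsometric {A B : Type*} [AddCommGroup A] [AddCommGroup B]
    (qA : A → Qmod2Z) (qB : B → Qmod2Z) : Prop :=
  ∃ e : A ≃+ B, ∀ x, qB (e x) = qA x

/-- An even lattice, given by its rank and Gram matrix: the Gram matrix is symmetric,
has even diagonal (so `(x,x)` is always even) and is nondegenerate. -/
structure EvenLattice : Type where
  n : ℕ
  B : Matrix (Fin n) (Fin n) ℤ
  symm : B.IsSymm
  even_diag : ∀ i, 2 ∣ B i i
  nondeg : B.det ≠ 0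

/-- The bilinear form of `L` extended to `R^n` for any commutative ring `R ⊇ ℤ`. -/
def formR (L : EvenLattice) (R : Type*) [CommRing R] (x y : Fin L.n → R) : R :=
  ∑ i, ∑ j, (L.B i j : R) * x i * y j

theorem formR_zero_left (L : EvenLattice) (R : Type*) [CommRing R] (y : Fin L.n → R) :
    formR L R 0 y = 0 := by
  simp [formR]

theorem formR_add_left (L : EvenLattice) (R : Type*) [CommRing R] (x x' y : Fin L.n → R) :
    formR L R (x + x') y = formR L R x y + formR L R x' y := by
  simp [formR, mul_add, add_mul, Finset.sum_add_distrib]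

theorem formR_neg_left (L : EvenLattice) (R : Type*) [CommRing R] (x y : Fin L.n → R) :
    formR L R (-x) y = -formR L R x y := by
  simp [formR, Finset.sum_neg_distrib]

/-- `L` and `M` are isometric over `R`. -/
def IsometricOver (R : Type*) [CommRing R] (L M : EvenLattice) : Prop :=
  ∃ e : (Fin L.n → R) ≃ₗ[R] (Fin M.n → R), ∀ x y, formR M R (e x) (e y) = formR L R x y

/-- `L` and `M` lie in the same genus: they are isometric over `ℤ_p` for all primes `p`
and over `ℝ`. -/
def SameGenus (L M : EvenLattice) : Prop :=
  (∀ (p : ℕ) [Fact p.Prime], IsometricOver ℤ_[p] L M) ∧ IsometricOver ℝ L M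

/-- The subgroup of integral vectors in `ℚ^n`, i.e. the lattice `L` itself inside `L ⊗ ℚ`. -/
def intSub (L : EvenLattice) : AddSubgroup (Fin L.n → ℚ) where
  carrier := {x | ∀ i, ∃ m : ℤ, x i = m}
  zero_mem' := fun i => ⟨0, by simp⟩
  add_mem' := by
    intro x y hx hy i
    obtain ⟨mx, hmx⟩ := hx i
    obtain ⟨my, hmy⟩ := hy i
    exact ⟨mx + my, by simp [hmx, hmy]⟩
  neg_mem' := by
    intro x hx i
    obtain ⟨m, hm⟩ := hx i
    exact ⟨-m, by simp [hm]⟩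

/-- The dual lattice of a subgroup `K` of `L ⊗ ℚ`:
all vectors pairing integrally with every element of `K`. -/
def dualOf (L : EvenLattice) (K : AddSubgroup (Fin L.n → ℚ)) : AddSubgroup (Fin L.n → ℚ) where
  carrier := {x | ∀ y ∈ K, ∃ m : ℤ, formR L ℚ x y = m}
  zero_mem' := fun y _ => ⟨0, by simp [formR_zero_left]⟩
  add_mem' := by
    intro x x' hx hx' y hy
    obtain ⟨m, hm⟩ := hx y hy
    obtain ⟨m', hm'⟩ := hx' y hy
    exact ⟨m + m', by rw [formR_add_left, hm, hm']; push_cast; ring⟩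
  neg_mem' := by
    intro x hx y hy
    obtain ⟨m, hm⟩ := hx y hy
    exact ⟨-m, by rw [formR_neg_left, hm]; push_cast; ring⟩

/-- The dual lattice `L^*` of `L`. -/
abbrev dualSub (L : EvenLattice) : AddSubgroup (Fin L.n → ℚ) := dualOf L (intSub L)

/-- The discriminant group `K^*/K` of a subgroup `K` of `L ⊗ ℚ`. -/
abbrev discGroupOf (L : EvenLattice) (K : AddSubgroup (Fin L.n → ℚ)) : Type :=
  dualOf L K ⧸ K.addSubgroupOf (dualOf L K)

/-- The discriminant group `L^*/L`. -/
abbrev discGroup (L : EvenLattice) : Type := discGroupOf L (intSub L)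

/-- The discriminant form on `K^*/K`, `q(x + K) = (x,x) mod 2ℤ`
(defined via a choice of representative; it is independent of this choice). -/
noncomputable def discQOf (L : EvenLattice) (K : AddSubgroup (Fin L.n → ℚ)) :
    discGroupOf L K → Qmod2Z :=
  fun a => (QuotientAddGroup.mk (formR L ℚ (a.out : Fin L.n → ℚ) (a.out : Fin L.n → ℚ)) : Qmod2Z)

/-- The discriminant form `q_L` on `L^*/L`. -/
noncomputable def discQ (L : EvenLattice) : discGroup L → Qmod2Z := discQOf L (intSub L)

/-- `n₊`: the maximal dimension of a positive definite subspace of `L ⊗ ℝ`. -/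
noncomputable def sigPlus (L : EvenLattice) : ℕ :=
  sSup {d : ℕ | ∃ W : Submodule ℝ (Fin L.n → ℝ), Module.finrank ℝ W = d ∧
    ∀ x ∈ W, x ≠ 0 → 0 < formR L ℝ x x}

/-- `n₋`: the maximal dimension of a negative definite subspace of `L ⊗ ℝ`. -/
noncomputable def sigMinus (L : EvenLattice) : ℕ :=
  sSup {d : ℕ | ∃ W : Submodule ℝ (Fin L.n → ℝ), Module.finrank ℝ W = d ∧
    ∀ x ∈ W, x ≠ 0 → formR L ℝ x x < 0}

end

/-- The even unimodular lattice `II_{1,1}`: `ℤ²` with Gram matrix `[[0,1],[1,0]]`. -/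
def hyperbolicPlane : EvenLattice where
  n := 2
  B := !![0, 1; 1, 0]
  symm := by
    unfold Matrix.IsSymm
    ext i j
    fin_cases i <;> fin_cases j <;> rfl
  even_diag := by
    intro i
    fin_cases i <;> decide
  nondeg := by
    rw [Matrix.det_fin_two_of]
    norm_num

/-- The orthogonal direct sum of two even lattices. -/
def dsum (L M : EvenLattice) : EvenLattice where
  n := L.n + M.n
  B := Matrix.reindex finSumFinEquiv finSumFinEquiv (Matrix.fromBlocks L.B 0 0 M.B)
  symm := by
    have h : (Matrix.fromBlocks L.B 0 0 M.B).IsSymm := by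
      unfold Matrix.IsSymm
      simp only [Matrix.fromBlocks_transpose, Matrix.transpose_zero]
      rw [L.symm, M.symm]
    exact h.submatrix _
  even_diag := by
    intro i
    rcases h : finSumFinEquiv.symm i with a | b
    · simpa [Matrix.reindex_apply, Matrix.submatrix_apply, h] using L.even_diag a
    · simpa [Matrix.reindex_apply, Matrix.submatrix_apply, h] using M.even_diag b
  nondeg := by
    rw [Matrix.reindex_apply, Matrix.det_submatrix_equiv_self, Matrix.det_fromBlocks_zero₂₁]
    exact mul_ne_zero L.nondeg M.nondeg


namespace SG

open LinearMap (BilinForm)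

section forms
variable {R : Type*} [CommRing R] {X Y Z W : Type*} [AddCommGroup X] [Module R X]
  [AddCommGroup Y] [Module R Y] [AddCommGroup Z] [Module R Z] [AddCommGroup W] [Module R W]

/-- Orthogonal sum of bilinear forms. -/
def pf (B : BilinForm R X) (C : BilinForm R Y) : BilinForm R (X × Y) :=
  B.compl₁₂ (LinearMap.fst R X Y) (LinearMap.fst R X Y) +
    C.compl₁₂ (LinearMap.snd R X Y) (LinearMap.snd R X Y)

@[simp] theorem pf_apply (B : BilinForm R X) (C : BilinForm R Y) (u v : X × Y) :
    pf B C u v = B u.1 v.1 + C u.2 v.2 := rfl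

/-- The hyperbolic plane. -/
def hyp (R : Type*) [CommRing R] : BilinForm R (R × R) :=
  LinearMap.mk₂ R (fun u v => u.1 * v.2 + u.2 * v.1)
    (by intros; simp; ring) (by intros; simp; ring) (by intros; simp; ring)
    (by intros; simp; ring)

@[simp] theorem hyp_apply (u v : R × R) : hyp R u v = u.1 * v.2 + u.2 * v.1 := rfl

/-- Isometry of bilinear forms. -/
def Isom (B : BilinForm R X) (C : BilinForm R Y) : Prop :=
  ∃ e : X ≃ₗ[R] Y, ∀ x y, C (e x) (e y) = B x y

theorem Isom.refl (B : BilinForm R X) : Isom B B := ⟨LinearEquiv.refl R X, fun _ _ => rfl⟩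

theorem Isom.symm {B : BilinForm R X} {C : BilinForm R Y} (h : Isom B C) : Isom C B := by
  obtain ⟨e, he⟩ := h
  exact ⟨e.symm, fun x y => by rw [← he]; simp⟩

theorem Isom.trans {B : BilinForm R X} {C : BilinForm R Y} {D : BilinForm R Z}
    (h : Isom B C) (h' : Isom C D) : Isom B D := by
  obtain ⟨e, he⟩ := h
  obtain ⟨f, hf⟩ := h'
  exact ⟨e.trans f, fun x y => by simp [hf, he]⟩

theorem Isom.prod {B : BilinForm R X} {C : BilinForm R Y} {D : BilinForm R Z}
    {E : BilinForm R W} (h : Isom B C) (h' : Isom D E) : Isom (pf B D) (pf C E) := by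
  obtain ⟨e, he⟩ := h
  obtain ⟨f, hf⟩ := h'
  exact ⟨e.prodCongr f, fun x y => by simp [hf, he]⟩

theorem Isom.comm (B : BilinForm R X) (C : BilinForm R Y) : Isom (pf B C) (pf C B) :=
  ⟨LinearEquiv.prodComm R X Y, fun x y => by simp [add_comm]⟩

theorem Isom.assoc (B : BilinForm R X) (C : BilinForm R Y) (D : BilinForm R Z) :
    Isom (pf (pf B C) D) (pf B (pf C D)) :=
  ⟨LinearEquiv.prodAssoc R X Y Z, fun x y => by simp [add_assoc]⟩

/-- Two vectors in the same orbit under the isometry group. -/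
def Orb (B : BilinForm R X) (x y : X) : Prop :=
  ∃ e : X ≃ₗ[R] X, (∀ u v, B (e u) (e v) = B u v) ∧ e x = y

theorem Orb.refl (B : BilinForm R X) (x : X) : Orb B x x :=
  ⟨LinearEquiv.refl R X, fun _ _ => rfl, rfl⟩

theorem Orb.trans {B : BilinForm R X} {x y z : X} (h : Orb B x y) (h' : Orb B y z) :
    Orb B x z := by
  obtain ⟨e, he, rfl⟩ := h
  obtain ⟨f, hf, rfl⟩ := h'
  exact ⟨e.trans f, fun u v => by simp [hf, he], rfl⟩

theorem Orb.map_iso {B : BilinForm R X} {x y : X} (h : Orb B x y) : B y y = B x x := by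
  obtain ⟨e, he, rfl⟩ := h
  exact he x x

/-- Cancellation of a hyperbolic plane once the image of the isotropic vector is standard. -/
theorem cancel_hyp {B : BilinForm R X} {C : BilinForm R Y}
    (e : (X × (R × R)) ≃ₗ[R] (Y × (R × R)))
    (he : ∀ u v, pf C (hyp R) (e u) (e v) = pf B (hyp R) u v)
    (h1 : e (0, (1, 0)) = (0, (1, 0))) : Isom B C := by
  have h1' : e.symm (0, (1, 0)) = (0, (1, 0)) := by rw [← h1]; simp
  have he' : ∀ u v, pf B (hyp R) (e.symm u) (e.symm v) = pf C (hyp R) u v := by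
    intro u v; rw [← he]; simp
  have k1 : ∀ x, (e (x, 0)).2.2 = 0 := by
    intro x
    have := he (x, 0) (0, (1, 0))
    rw [h1] at this
    simpa using this
  have k2 : ∀ x, (e.symm (x, 0)).2.2 = 0 := by
    intro x
    have := he' (x, 0) (0, (1, 0))
    rw [h1'] at this
    simpa using this
  have m1 : ∀ c : R, e (0, (c, 0)) = (0, (c, 0)) := by
    intro c
    have : ((0, (c, 0)) : X × (R × R)) = c • (0, (1, 0)) := by simp
    rw [this, map_smul, h1]; simp
  have m2 : ∀ c : R, e.symm (0, (c, 0)) = (0, (c, 0)) := by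
    intro c
    rw [← m1]; simp
  have d1 : ∀ x, e (x, 0) = ((e (x, 0)).1, 0) + (0, ((e (x, 0)).2.1, 0)) := by
    intro x
    ext <;> simp [k1]
  have d2 : ∀ x, e.symm (x, 0) = ((e.symm (x, 0)).1, 0) + (0, ((e.symm (x, 0)).2.1, 0)) := by
    intro x
    ext <;> simp [k2]
  let g : X →ₗ[R] Y := (LinearMap.fst R Y (R × R)) ∘ₗ e.toLinearMap ∘ₗ (LinearMap.inl R X (R × R))
  let h : Y →ₗ[R] X := (LinearMap.fst R X (R × R)) ∘ₗ e.symm.toLinearMap ∘ₗ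
    (LinearMap.inl R Y (R × R))
  have hg : ∀ x, g x = (e (x, 0)).1 := fun _ => rfl
  have hh : ∀ x, h x = (e.symm (x, 0)).1 := fun _ => rfl
  refine ⟨LinearEquiv.ofLinearMap g h ?_ ?_, ?_⟩
  · ext y
    simp only [LinearMap.comp_apply, LinearMap.id_apply]
    rw [hg, hh]
    have : (((e.symm (y, 0)).1, 0) : X × (R × R)) =
      e.symm (y, 0) - (0, ((e.symm (y, 0)).2.1, 0)) := by
      rw [eq_sub_iff_add_eq]; exact (d2 y).symm
    rw [this, map_sub, m1]
    simp
  · ext y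
    simp only [LinearMap.comp_apply, LinearMap.id_apply]
    rw [hg, hh]
    have : (((e (y, 0)).1, 0) : Y × (R × R)) =
      e (y, 0) - (0, ((e (y, 0)).2.1, 0)) := by
      rw [eq_sub_iff_add_eq]; exact (d1 y).symm
    rw [this, map_sub, m2]
    simp
  · intro x y
    have := he (x, 0) (y, 0)
    simp only [pf_apply, hyp_apply, k1] at this
    simpa [hg] using this

theorem cancel_hyp' {B : BilinForm R X} {C : BilinForm R Y}
    (hI : Isom (pf B (hyp R)) (pf C (hyp R)))
    (horb : ∀ u v : Y × (R × R), pf C (hyp R) u u = 0 → pf C (hyp R) u v = 1 →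
      Orb (pf C (hyp R)) u (0, (1, 0))) : Isom B C := by
  obtain ⟨e, he⟩ := hI
  obtain ⟨f, hf, hf1⟩ := horb (e (0, (1, 0))) (e (0, (0, 1))) (by rw [he]; simp) (by rw [he]; simp)
  exact cancel_hyp (e.trans f) (fun u v => by simp only [LinearEquiv.trans_apply, hf, he])
    (by simpa using hf1)

/-- An even form. -/
def EvenForm (B : BilinForm R X) : Prop := ∀ x, ∃ c, B x x = 2 * c

/-- Eichler transformation. -/
theorem orb_eichler {B : BilinForm R X} (hs : ∀ x y, B x y = B y x) (y : X) (c : R)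
    (hc : B y y = 2 * c) (x : X) (a b : R) :
    Orb (pf B (hyp R)) (x, (a, b)) (x + b • y, (a - B y x - c * b, b)) := by
  let E : X → R → (X × (R × R)) →ₗ[R] (X × (R × R)) := fun y c =>
    { toFun := fun u => (u.1 + u.2.2 • y, (u.2.1 - B y u.1 - c * u.2.2, u.2.2))
      map_add' := by
        intro u v
        ext
        · simp [add_smul]; abel
        · simp; ring
        · simp
      map_smul' := by
        intro r u
        ext
        · simp [mul_smul]
        · simp; ring
        · simp }
  have hE : ∀ y c u, E y c u = (u.1 + u.2.2 • y, (u.2.1 - B y u.1 - c * u.2.2, u.2.2)) :=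
    fun _ _ _ => rfl
  refine ⟨LinearEquiv.ofLinearMap (E y c) (E (-y) c) ?_ ?_, ?_, ?_⟩
  · refine LinearMap.ext fun u => ?_
    simp only [LinearMap.comp_apply, hE, LinearMap.id_apply]
    ext <;> simp [hc]; ring
  · refine LinearMap.ext fun u => ?_
    simp only [LinearMap.comp_apply, hE, LinearMap.id_apply]
    ext <;> simp [hc]; ring
  · intro u v
    simp only [LinearEquiv.coe_ofLinearMap, hE, pf_apply, hyp_apply, map_add, map_smul,
      LinearMap.add_apply, LinearMap.smul_apply, smul_eq_mul, hc, hs u.1 y]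
    ring
  · rfl

theorem orb_swap (B : BilinForm R X) (x : X) (a b : R) :
    Orb (pf B (hyp R)) (x, (a, b)) (x, (b, a)) :=
  ⟨(LinearEquiv.refl R X).prodCongr (LinearEquiv.prodComm R R R),
    fun u v => by simp; ring, rfl⟩

theorem orb_eichler' {B : BilinForm R X} (hs : ∀ x y, B x y = B y x) (y : X) (c : R)
    (hc : B y y = 2 * c) (x : X) (a b : R) :
    Orb (pf B (hyp R)) (x, (a, b)) (x + a • y, (a, b - B y x - c * a)) :=
  ((orb_swap B x a b).trans (orb_eichler hs y c hc x b a)).trans (orb_swap B _ _ _)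

theorem orb_unit (B : BilinForm R X) (x : X) (a b : R) (w : Rˣ) :
    Orb (pf B (hyp R)) (x, (a, b)) (x, (w * a, (w⁻¹ : Rˣ) * b)) := by
  refine ⟨(LinearEquiv.refl R X).prodCongr ((LinearEquiv.smulOfUnit w).prodCongr
    (LinearEquiv.smulOfUnit w⁻¹)), fun u v => ?_, ?_⟩
  · change B u.1 v.1 + ((w : R) * u.2.1 * (((w⁻¹ : Rˣ) : R) * v.2.2) +
      ((w⁻¹ : Rˣ) : R) * u.2.2 * ((w : R) * v.2.1)) = B u.1 v.1 + (u.2.1 * v.2.2 + u.2.2 * v.2.1)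
    have : (w : R) * (w⁻¹ : Rˣ) = 1 := by simp
    linear_combination (u.2.1 * v.2.2 + u.2.2 * v.2.1) * this
  · rfl

/-- A vector with unit first hyperbolic coordinate is standard. -/
theorem orb_of_unit {B : BilinForm R X} (hs : ∀ x y, B x y = B y x) (hev : EvenForm B)
    (h2 : ∀ r : R, 2 * r = 0 → r = 0) (x : X) (a b : R) (ha : IsUnit a)
    (h0 : pf B (hyp R) (x, (a, b)) (x, (a, b)) = 0) :
    Orb (pf B (hyp R)) (x, (a, b)) (0, (1, 0)) := by
  obtain ⟨w, rfl⟩ := ha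
  have h1 := orb_unit B x (w : R) b w⁻¹
  simp only [Units.inv_mul, inv_inv] at h1
  obtain ⟨c, hc⟩ := hev (-x)
  have h3 := h1.trans (orb_eichler' hs (-x) c hc x 1 _)
  simp only [one_smul, add_neg_cancel] at h3
  have h4 := h3.map_iso
  rw [h0] at h4
  simp only [pf_apply, hyp_apply] at h4
  simp only [map_zero, zero_add, one_mul, mul_one] at h4
  rw [← two_mul] at h4
  have h5 := h2 _ h4
  rw [mul_one, h5] at h3
  exact h3

/-- Cancellation over local rings. -/
theorem cancel_local [IsLocalRing R] {B : BilinForm R X} {C : BilinForm R Y}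
    (hs : ∀ x y, C x y = C y x) (hev : EvenForm C)
    (h2 : ∀ r : R, 2 * r = 0 → r = 0)
    (hI : Isom (pf B (hyp R)) (pf C (hyp R))) : Isom B C := by
  refine cancel_hyp' hI ?_
  rintro ⟨x, a, b⟩ ⟨y, a', b'⟩ h0 h1
  by_cases ha : IsUnit a
  · exact orb_of_unit hs hev h2 x a b ha h0
  by_cases hb : IsUnit b
  · have := orb_swap C x a b
    exact this.trans (orb_of_unit hs hev h2 x b a hb (by rw [this.map_iso, h0]))
  obtain ⟨c, hc⟩ := hev y
  have h3 := orb_eichler hs y c hc x a b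
  refine h3.trans (orb_of_unit hs hev h2 _ _ _ ?_ (by rw [h3.map_iso, h0]))
  have hm : ∀ r : R, ¬ IsUnit r ↔ r ∈ IsLocalRing.maximalIdeal R := fun r => by
    rw [IsLocalRing.mem_maximalIdeal]; rfl
  by_contra hcon
  rw [hm] at ha hb hcon
  simp only [pf_apply, hyp_apply] at h1
  have : (1 : R) ∈ IsLocalRing.maximalIdeal R := by
    have e : (1 : R) = (a * b' + b * a') - (a - C y x - c * b) + a - c * b := by
      rw [← h1, hs x y]; ring
    rw [e]
    refine sub_mem (add_mem (sub_mem (add_mem ?_ ?_) hcon) ha) ?_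
    · exact Ideal.mul_mem_right _ _ ha
    · exact Ideal.mul_mem_right _ _ hb
    · exact Ideal.mul_mem_left _ _ hb
  exact (Ideal.ne_top_iff_one _).mp (IsLocalRing.maximalIdeal.isMaximal R).ne_top this

end forms
end SG


namespace SG

open LinearMap (BilinForm)

section intcancel
variable {X Y : Type*} [AddCommGroup X] [AddCommGroup Y]

theorem Orb.left {R : Type*} [CommRing R] {X Y : Type*} [AddCommGroup X] [Module R X]
    [AddCommGroup Y] [Module R Y] {B : BilinForm R X} (C : BilinForm R Y) {u v : X}
    (h : Orb B u v) (c : Y) : Orb (pf B C) (u, c) (v, c) := by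
  obtain ⟨e, he, rfl⟩ := h
  exact ⟨e.prodCongr (LinearEquiv.refl R Y), fun u v => by simp [he], rfl⟩

theorem orb_swap2 {R : Type*} [CommRing R] {X : Type*} [AddCommGroup X] [Module R X]
    (B : BilinForm R X) (x : X) (p q : R × R) :
    Orb (pf (pf B (hyp R)) (hyp R)) ((x, p), q) ((x, q), p) := by
  let s : ((X × (R × R)) × (R × R)) →ₗ[R] ((X × (R × R)) × (R × R)) :=
    { toFun := fun u => ((u.1.1, u.2), u.1.2)
      map_add' := fun _ _ => rfl
      map_smul' := fun _ _ => rfl }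
  refine ⟨LinearEquiv.ofLinearMap s s rfl rfl, fun u v => ?_, rfl⟩
  change B u.1.1 v.1.1 + hyp R u.2 v.2 + hyp R u.1.2 v.1.2 =
    B u.1.1 v.1.1 + hyp R u.1.2 v.1.2 + hyp R u.2 v.2
  ring

theorem even_pf {R : Type*} [CommRing R] {X : Type*} [AddCommGroup X] [Module R X]
    {B : BilinForm R X} (hev : EvenForm B) : EvenForm (pf B (hyp R)) := by
  rintro ⟨x, a, b⟩
  obtain ⟨c, hc⟩ := hev x
  exact ⟨c + a * b, by simp [hc]; ring⟩

theorem symm_pf {R : Type*} [CommRing R] {X : Type*} [AddCommGroup X] [Module R X]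
    {B : BilinForm R X} (hs : ∀ x y, B x y = B y x) :
    ∀ x y, pf B (hyp R) x y = pf B (hyp R) y x := by
  rintro ⟨x, a, b⟩ ⟨y, c, d⟩
  simp [hs x y]; ring

theorem orb_int {B : BilinForm ℤ X} (hs : ∀ x y, B x y = B y x) (hev : EvenForm B)
    (u v : (X × (ℤ × ℤ)) × (ℤ × ℤ))
    (h0 : pf (pf B (hyp ℤ)) (hyp ℤ) u u = 0) (h1 : pf (pf B (hyp ℤ)) (hyp ℤ) u v = 1) :
    Orb (pf (pf B (hyp ℤ)) (hyp ℤ)) u (0, (1, 0)) := by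
  set F := pf (pf B (hyp ℤ)) (hyp ℤ) with hF
  have hs' := symm_pf hs
  let S : Set ℕ := {k | ∃ x p a b, Orb F u ((x, p), (a, b)) ∧ a ≠ 0 ∧ a.natAbs = k}
  have hne : S.Nonempty := by
    obtain ⟨⟨x, a2, b2⟩, a, b⟩ := u
    by_cases ha : a ≠ 0
    · exact ⟨_, x, _, a, b, Orb.refl _ _, ha, rfl⟩
    by_cases hb : b ≠ 0
    · exact ⟨_, x, _, b, a, orb_swap _ _ _ _, hb, rfl⟩
    by_cases ha2 : a2 ≠ 0
    · exact ⟨_, x, _, a2, b2, orb_swap2 _ _ _ _, ha2, rfl⟩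
    by_cases hb2 : b2 ≠ 0
    · exact ⟨_, x, _, b2, a2, (orb_swap2 _ _ _ _).trans (orb_swap _ _ _ _), hb2, rfl⟩
    push Not at ha hb ha2 hb2
    subst ha hb ha2 hb2
    obtain ⟨⟨y, a2', b2'⟩, a', b'⟩ := v
    obtain ⟨c, hc⟩ := hev y
    have := ((orb_eichler hs y c hc x 0 0).left (hyp ℤ) (0, 0)).trans (orb_swap2 B _ _ _)
    refine ⟨_, _, _, _, _, this, ?_, rfl⟩
    simp [hF] at h1
    rw [hs y x, h1]
    norm_num
  obtain ⟨x, p, a, b, hO, ha, hk⟩ := Nat.sInf_mem hne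
  have hmin : ∀ x p a' b', Orb F u ((x, p), (a', b')) → a'.natAbs < a.natAbs → a' = 0 := by
    intro x' p' a' b' h hlt
    by_contra h'
    have : sInf S ≤ a'.natAbs := Nat.sInf_le ⟨x', p', a', b', h, h', rfl⟩
    omega
  -- divisibility
  have T1 : ∀ (t : ℤ) x c d b, Orb F u ((x, (c, d)), (a, b)) →
      Orb F u ((x, (c + a * t, d)), (a, b - t * d)) := by
    intro t x c d b h
    have := h.trans (orb_eichler' hs' ((0 : X), (t, (0 : ℤ))) 0 (by simp) (x, (c, d)) a b)
    simpa using this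
  have T2 : ∀ (t : ℤ) x c d b, Orb F u ((x, (c, d)), (a, b)) →
      Orb F u ((x, (c, d + a * t)), (a, b - t * c)) := by
    intro t x c d b h
    have := h.trans (orb_eichler' hs' ((0 : X), ((0 : ℤ), t)) 0 (by simp) (x, (c, d)) a b)
    simpa using this
  have D1 : ∀ x c d b, Orb F u ((x, (c, d)), (a, b)) → a ∣ c := by
    intro x c d b h
    have h3 := (T1 (-(c / a)) x c d b h).trans (orb_swap2 B _ _ _)
    have e : c + a * -(c / a) = c % a := by
      have := Int.emod_add_mul_ediv c a
      linarith
    rw [e] at h3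
    have hlt : (c % a).natAbs < a.natAbs := by
      have h5 := Int.emod_nonneg c ha
      have h6 := Int.emod_lt_abs c ha
      rw [Int.abs_eq_natAbs] at h6
      omega
    exact Int.dvd_of_emod_eq_zero (hmin _ _ _ _ h3 hlt)
  have D2 : ∀ x c d b, Orb F u ((x, (c, d)), (a, b)) → a ∣ d := by
    intro x c d b h
    exact D1 x d c b (h.trans ((orb_swap B x c d).left (hyp ℤ) (a, b)))
  obtain ⟨c, d⟩ := p
  obtain ⟨c', hc'⟩ := D1 x c d b hO
  have hO1 := T1 (-c') x c d b hO
  obtain ⟨d', hd'⟩ := D2 _ _ _ _ hO1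
  have hO2 := T2 (-d') _ _ _ _ hO1
  rw [show c + a * -c' = 0 by rw [hc']; ring, show d + a * -d' = 0 by rw [hd']; ring] at hO2
  set b0 := b - -c' * d - -d' * 0 with hb0
  clear_value b0
  have E1 : ∀ y, a ∣ B y x := by
    intro y
    obtain ⟨c, hc⟩ := hev y
    have h3 := hO2.trans ((orb_eichler hs y c hc x 0 0).left (hyp ℤ) (a, b0))
    simp only [zero_smul, add_zero, mul_zero, sub_zero, zero_sub] at h3
    exact (dvd_neg).mp (D1 _ _ _ _ h3)
  have E2 : a ∣ b0 := by
    have h3 := hO2.trans (orb_eichler hs' ((0 : X), ((1 : ℤ), (0 : ℤ))) 0 (by simp)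
      (x, (0, 0)) a b0)
    have h4 : Orb F u ((x, (b0, 0)), (a, b0)) := by simpa using h3
    exact D1 _ _ _ _ h4
  have hunit : IsUnit a := by
    obtain ⟨e, he, heu⟩ := hO2
    have h3 := he u v
    rw [h1, heu] at h3
    simp only [hF, pf_apply, hyp_apply] at h3
    rw [isUnit_iff_dvd_one, ← h3]
    refine dvd_add (dvd_add ?_ ?_) (dvd_add ?_ ?_)
    · rw [hs]; exact E1 _
    · simp
    · exact dvd_mul_right _ _
    · exact E2.mul_right _
  refine hO2.trans (orb_of_unit hs' (even_pf hev) (fun r hr => by omega) _ _ _ hunit ?_)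
  rw [hO2.map_iso, h0]

theorem cancel_int {B : BilinForm ℤ X} {C : BilinForm ℤ Y}
    (hs : ∀ x y, C x y = C y x) (hev : EvenForm C)
    (hI : Isom (pf (pf B (hyp ℤ)) (hyp ℤ)) (pf (pf C (hyp ℤ)) (hyp ℤ))) :
    Isom (pf B (hyp ℤ)) (pf C (hyp ℤ)) :=
  cancel_hyp' hI (orb_int hs hev)

end intcancel
end SG


namespace SG

open LinearMap (BilinForm)

section stab

/-- Sum of `n` hyperbolic planes. -/
def hypn (n : ℕ) : BilinForm ℤ ((Fin n → ℤ) × (Fin n → ℤ)) :=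
  LinearMap.mk₂ ℤ (fun u v => u.1 ⬝ᵥ v.2 + u.2 ⬝ᵥ v.1)
    (by intros; simp only [Prod.fst_add, Prod.snd_add, add_dotProduct]; ring)
    (by intros; simp only [Prod.smul_fst, Prod.smul_snd, smul_dotProduct, smul_add])
    (by intros; simp only [Prod.fst_add, Prod.snd_add, dotProduct_add]; ring)
    (by intros; simp only [Prod.smul_fst, Prod.smul_snd, dotProduct_smul, smul_add])

theorem hypn_apply (n : ℕ) (u v) : hypn n u v = u.1 ⬝ᵥ v.2 + u.2 ⬝ᵥ v.1 := rfl

variable {X Y Z : Type*} [AddCommGroup X] [AddCommGroup Y] [AddCommGroup Z]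

theorem hypn_zero (B : BilinForm ℤ X) : Isom (pf B (hypn 0)) B :=
  ⟨LinearEquiv.ofLinearMap (LinearMap.fst ℤ X _) (LinearMap.inl ℤ X _) rfl
    (by ext x <;> first | rfl | simp [Subsingleton.elim x.2 0] | exact Fin.elim0 ‹_›),
    fun x y => by
      change B x.1 y.1 = B x.1 y.1 + (x.2.1 ⬝ᵥ y.2.2 + x.2.2 ⬝ᵥ y.2.1)
      simp⟩

theorem hypn_succ (n : ℕ) : Isom (hypn (n + 1)) (pf (hypn n) (hyp ℤ)) := by
  let f : ((Fin (n + 1) → ℤ) × (Fin (n + 1) → ℤ)) →ₗ[ℤ]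
      (((Fin n → ℤ) × (Fin n → ℤ)) × (ℤ × ℤ)) :=
    { toFun := fun u => ((Fin.tail u.1, Fin.tail u.2), (u.1 0, u.2 0))
      map_add' := fun _ _ => rfl
      map_smul' := fun _ _ => rfl }
  let g : (((Fin n → ℤ) × (Fin n → ℤ)) × (ℤ × ℤ)) →ₗ[ℤ]
      ((Fin (n + 1) → ℤ) × (Fin (n + 1) → ℤ)) :=
    { toFun := fun u => (Fin.cons u.2.1 u.1.1, Fin.cons u.2.2 u.1.2)
      map_add' := by
        intro u v
        ext i <;> refine Fin.cases ?_ (fun i => ?_) i <;> simp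
      map_smul' := by
        intro u v
        ext i <;> refine Fin.cases ?_ (fun i => ?_) i <;> simp }
  refine ⟨LinearEquiv.ofLinearMap f g ?_ ?_, ?_⟩
  · refine LinearMap.ext fun u => ?_
    rfl
  · refine LinearMap.ext fun u => ?_
    change ((Fin.cons (u.1 0) (Fin.tail u.1), Fin.cons (u.2 0) (Fin.tail u.2)) :
      (Fin (n + 1) → ℤ) × (Fin (n + 1) → ℤ)) = u
    simp
  · intro u v
    change Fin.tail u.1 ⬝ᵥ Fin.tail v.2 + Fin.tail u.2 ⬝ᵥ Fin.tail v.1 +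
      (u.1 0 * v.2 0 + u.2 0 * v.1 0) = u.1 ⬝ᵥ v.2 + u.2 ⬝ᵥ v.1
    simp only [dotProduct, Fin.sum_univ_succ, Fin.tail]
    ring

theorem hypn_even (B : BilinForm ℤ X) (hB : EvenForm B) (n : ℕ) : EvenForm (pf B (hypn n)) := by
  rintro ⟨x, u⟩
  obtain ⟨c, hc⟩ := hB x
  refine ⟨c + u.1 ⬝ᵥ u.2, ?_⟩
  simp only [pf_apply, hc, hypn_apply, dotProduct_comm u.2 u.1]
  ring

theorem hypn_symm (B : BilinForm ℤ X) (hB : ∀ x y, B x y = B y x) (n : ℕ) :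
    ∀ x y, pf B (hypn n) x y = pf B (hypn n) y x := by
  intro u v
  simp only [pf_apply, hypn_apply]
  rw [hB, dotProduct_comm u.2.1, dotProduct_comm u.2.2]
  ring

theorem hypn_shift (B : BilinForm ℤ X) (n : ℕ) :
    Isom (pf B (hypn (n + 1))) (pf (pf B (hypn n)) (hyp ℤ)) :=
  ((Isom.refl B).prod (hypn_succ n)).trans (Isom.assoc _ _ _).symm

theorem cancel_hypn {B : BilinForm ℤ X} {C : BilinForm ℤ Y}
    (hs : ∀ x y, C x y = C y x) (hev : EvenForm C) (n : ℕ)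
    (hI : Isom (pf B (hypn (n + 1))) (pf C (hypn (n + 1)))) :
    Isom (pf B (hyp ℤ)) (pf C (hyp ℤ)) := by
  induction n with
  | zero =>
    have h1 : ∀ {X : Type _} [AddCommGroup X] (B : BilinForm ℤ X),
        Isom (pf B (hypn 1)) (pf B (hyp ℤ)) := fun B =>
      (hypn_shift B 0).trans ((hypn_zero B).prod (Isom.refl _))
    have h2 : ∀ {X : Type _} [AddCommGroup X] (B : BilinForm ℤ X),
        Isom (pf B (hypn 1)) (pf B (hyp ℤ)) := fun B =>
      (hypn_shift B 0).trans ((hypn_zero B).prod (Isom.refl _))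
    exact ((h1 B).symm.trans hI).trans (h2 C)
  | succ n ih =>
    apply ih
    have h1 := (hypn_shift B (n + 1)).trans ((hypn_shift B n).prod (Isom.refl _))
    have h2 := (hypn_shift C (n + 1)).trans ((hypn_shift C n).prod (Isom.refl _))
    have h3 := cancel_int (hypn_symm C hs n) (hypn_even C hev n) ((h1.symm.trans hI).trans h2)
    exact ((hypn_shift B n).trans h3).trans (hypn_shift C n).symm

theorem even_split_mat {n : ℕ} (A : Matrix (Fin n) (Fin n) ℤ) (hs : A.IsSymm)
    (hev : ∀ i, 2 ∣ A i i) : ∃ K : Matrix (Fin n) (Fin n) ℤ, K + K.transpose = A := by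
  refine ⟨Matrix.of fun i j =>
    if i = j then A i i / 2 else if i < j then A i j else 0, ?_⟩
  ext i j
  simp only [Matrix.add_apply, Matrix.transpose_apply, Matrix.of_apply]
  rcases lt_trichotomy i j with h | h | h
  · simp [h, h.ne, h.ne', h.not_gt]
  · subst h
    obtain ⟨c, hc⟩ := hev i
    simp [hc]; ring
  · simp [h, h.ne, h.ne', h.not_gt]
    exact hs.apply i j

theorem even_split {n : ℕ} (C : BilinForm ℤ (Fin n → ℤ)) (hs : ∀ x y, C x y = C y x)
    (hev : EvenForm C) : ∃ κ : (Fin n → ℤ) →ₗ[ℤ] (Fin n → ℤ),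
      ∀ b b', κ b ⬝ᵥ b' + b ⬝ᵥ κ b' = C b b' := by
  let A : Matrix (Fin n) (Fin n) ℤ := LinearMap.toMatrix₂' ℤ C
  have hA : ∀ i j, A i j = C (Pi.single i 1) (Pi.single j 1) := fun i j => by
    simp [A, LinearMap.toMatrix₂'_apply]
  obtain ⟨K, hK⟩ := even_split_mat A (Matrix.IsSymm.ext fun i j => by rw [hA, hA, hs])
    (fun i => by rw [hA]; exact hev _)
  refine ⟨K.mulVecLin, fun b b' => ?_⟩
  have h1 : C b b' = b ⬝ᵥ A.mulVec b' := by
    have : C = Matrix.toLinearMap₂' ℤ A := by simp [A]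
    rw [this, Matrix.toLinearMap₂'_apply']
  rw [h1, ← hK, Matrix.add_mulVec, dotProduct_add, Matrix.mulVecLin_apply, Matrix.mulVecLin_apply,
    add_comm, dotProduct_comm (K.mulVec b) b', Matrix.dotProduct_mulVec b', ← Matrix.mulVec_transpose,
    dotProduct_comm _ b]

/-- Splitting off hyperbolic planes along an isotropic sublattice. -/
theorem split_isotropic {n : ℕ} {F : BilinForm ℤ Z} {B : BilinForm ℤ X}
    (hs : ∀ x y, F x y = F y x) (hev : EvenForm F)
    (hB : ∀ x, (∀ y, B x y = 0) → x = 0)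
    (i g : (Fin n → ℤ) →ₗ[ℤ] Z) (s : X →ₗ[ℤ] Z)
    (hii : ∀ a b, F (i a) (i b) = 0) (hig : ∀ a b, F (i a) (g b) = a ⬝ᵥ b)
    (hsi : ∀ x a, F (s x) (i a) = 0) (hss : ∀ x y, F (s x) (s y) = B x y)
    (hperp : ∀ z, (∀ a, F z (i a) = 0) → ∃ x a, z = s x + i a) :
    Isom (pf B (hypn n)) F := by
  obtain ⟨κ, hκ⟩ := even_split (F.compl₁₂ g g) (fun x y => hs _ _) (fun x => hev (g x))
  simp only [LinearMap.compl₁₂_apply] at hκ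
  let k : X →ₗ[ℤ] (Fin n → ℤ) := LinearMap.pi fun j =>
    (F.flip (g (Pi.single j 1))) ∘ₗ s
  have hk : ∀ x b, k x ⬝ᵥ b = F (s x) (g b) := by
    intro x b
    have : b = ∑ j, b j • Pi.single j (1 : ℤ) := by
      simpa using (pi_eq_sum_univ' b)
    conv_rhs => rw [this]
    simp only [map_sum, map_smul, smul_eq_mul]
    exact Finset.sum_congr rfl fun j _ => mul_comm _ _
  let g' : (Fin n → ℤ) →ₗ[ℤ] Z := g - i ∘ₗ κ
  let s' : X →ₗ[ℤ] Z := s - i ∘ₗ k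
  have hg' : ∀ b, g' b = g b - i (κ b) := fun _ => rfl
  have hs' : ∀ b, s' b = s b - i (k b) := fun _ => rfl
  have hgi : ∀ a b, F (g b) (i a) = a ⬝ᵥ b := fun a b => by rw [hs, hig]
  have his : ∀ x a, F (i a) (s x) = 0 := fun a b => by rw [hs, hsi]
  have e1 : ∀ a b, F (i a) (g' b) = a ⬝ᵥ b := by
    intro a b; simp [hg', hig, hii]
  have e2 : ∀ a b, F (g' a) (g' b) = 0 := by
    intro a b
    have := hκ a b
    simp only [hg', map_sub, LinearMap.sub_apply, hig, hii, hgi]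
    rw [← this, dotProduct_comm a]; ring
  have e3 : ∀ x a, F (s' x) (i a) = 0 := by
    intro x a; simp [hs', hsi, hii]
  have e4 : ∀ x b, F (s' x) (g' b) = 0 := by
    intro x b
    simp only [hs', hg', map_sub, LinearMap.sub_apply, hig, hii, hsi]
    rw [hk]; ring
  have e5 : ∀ x y, F (s' x) (s' y) = B x y := by
    intro x y
    simp only [hs', map_sub, LinearMap.sub_apply, hss, hii, hsi, his]
    ring
  let Φ : (X × ((Fin n → ℤ) × (Fin n → ℤ))) →ₗ[ℤ] Z :=
    s'.coprod (i.coprod g')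
  have hΦ : ∀ u, Φ u = s' u.1 + (i u.2.1 + g' u.2.2) := fun _ => rfl
  have e6 : ∀ u v, F (Φ u) (Φ v) = pf B (hypn n) u v := by
    intro u v
    simp only [hΦ, map_add, LinearMap.add_apply, e1, e2, e3, e4, e5, hii,
      hs (i _) (s' _), hs (g' _) (s' _), hs (g' _) (i _), pf_apply, hypn_apply]
    rw [dotProduct_comm u.2.2]
    ring
  have inj : Function.Injective Φ := by
    rw [injective_iff_map_eq_zero]
    intro u hu
    have h0 : ∀ v, pf B (hypn n) u v = 0 := by
      intro v; rw [← e6, hu]; simp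
    have h1 : u.1 = 0 := hB _ (fun y => by simpa using h0 (y, 0))
    have h2 : u.2.1 = 0 := by
      funext j
      have := h0 (0, (0, Pi.single j 1))
      simpa [hypn_apply] using this
    have h3 : u.2.2 = 0 := by
      funext j
      have := h0 (0, (Pi.single j 1, 0))
      simpa [hypn_apply] using this
    ext <;> simp [h1, h2, h3]
  have surj : Function.Surjective Φ := by
    intro z
    let b : Fin n → ℤ := fun j => F z (i (Pi.single j 1))
    have hb : ∀ a, F z (i a) = a ⬝ᵥ b := by
      intro a
      have : a = ∑ j, a j • Pi.single j (1 : ℤ) := by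
        simpa using (pi_eq_sum_univ' a)
      conv_lhs => rw [this]
      simp only [map_sum, map_smul, smul_eq_mul]
      rfl
    obtain ⟨x, a, hxa⟩ := hperp (z - g' b) (by
      intro a
      rw [map_sub, LinearMap.sub_apply, hb, hs (g' b), e1, sub_self])
    refine ⟨(x, (a + k x, b)), ?_⟩
    rw [hΦ]
    simp only [hs', map_add]
    rw [sub_eq_iff_eq_add.mp hxa]
    abel
  exact ⟨LinearEquiv.ofBijective Φ ⟨inj, surj⟩, e6⟩

end stab
end SG


namespace SG

open LinearMap (BilinForm)

section transl

/-- The bilinear form over `R` of an integral matrix. -/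
def mf (R : Type*) [CommRing R] {κ : Type*} [Fintype κ] [DecidableEq κ] (A : Matrix κ κ ℤ) :
    BilinForm R (κ → R) :=
  Matrix.toLinearMap₂' R (A.map (Int.cast : ℤ → R))

theorem mf_apply (R : Type*) [CommRing R] {κ : Type*} [Fintype κ] [DecidableEq κ] (A : Matrix κ κ ℤ)
    (x y : κ → R) : mf R A x y = x ⬝ᵥ (A.map (Int.cast : ℤ → R)).mulVec y :=
  Matrix.toLinearMap₂'_apply' _ _ _

theorem mf_formR (R : Type*) [CommRing R] (L : EvenLattice) (x y : Fin L.n → R) :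
    mf R L.B x y = formR L R x y := by
  rw [mf_apply]
  simp only [formR, dotProduct, Matrix.mulVec, Matrix.map_apply, Finset.mul_sum]
  exact Finset.sum_congr rfl fun i _ => Finset.sum_congr rfl fun j _ => by ring

theorem isometricOver_iff (R : Type*) [CommRing R] (L M : EvenLattice) :
    IsometricOver R L M ↔ Isom (mf R L.B) (mf R M.B) := by
  simp only [IsometricOver, Isom, mf_formR]

theorem formR_dsum (R : Type*) [CommRing R] (L M : EvenLattice)
    (x y : Fin (dsum L M).n → R) : formR (dsum L M) R x y =
      formR L R (fun i => x (Fin.castAdd M.n i)) (fun i => y (Fin.castAdd M.n i)) +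
      formR M R (fun i => x (Fin.natAdd L.n i)) (fun i => y (Fin.natAdd L.n i)) := by
  have : formR (dsum L M) R x y = ∑ i : Fin (L.n + M.n), ∑ j : Fin (L.n + M.n),
    ((Matrix.reindex finSumFinEquiv finSumFinEquiv (Matrix.fromBlocks L.B 0 0 M.B) i j : ℤ) : R)
      * x i * y j := rfl
  rw [this]
  simp [formR, Fin.sum_univ_add]

theorem dsum_iso (R : Type*) [CommRing R] (L : EvenLattice) :
    Isom (mf R (dsum L hyperbolicPlane).B) (pf (mf R L.B) (hyp R)) := by
  let f : (Fin (L.n + 2) → R) ≃ₗ[R] ((Fin L.n → R) × (R × R)) :=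
    (LinearEquiv.funCongrLeft R R (finSumFinEquiv (m := L.n) (n := 2))).trans
      ((LinearEquiv.sumArrowLequivProdArrow (Fin L.n) (Fin 2) R R).trans
        ((LinearEquiv.refl R (Fin L.n → R)).prodCongr (LinearEquiv.finTwoArrow R R)))
  refine ⟨f, fun x y => ?_⟩
  rw [mf_formR R (dsum L hyperbolicPlane), formR_dsum]
  have h1 : ∀ u : Fin (L.n + 2) → R, f u = ((fun i => u (Fin.castAdd 2 i)),
    (u (Fin.natAdd L.n 0), u (Fin.natAdd L.n 1))) := fun u => rfl
  refine Eq.trans (congrArg₂ (fun u v => pf (mf R L.B) (hyp R) u v) (h1 x) (h1 y)) ?_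
  rw [pf_apply, hyp_apply, mf_formR]
  congr 1
  have : ∀ a b : Fin 2 → R, formR hyperbolicPlane R a b = a 0 * b 1 + a 1 * b 0 := by
    intro a b
    change ∑ i : Fin 2, ∑ j : Fin 2, (((!![0, 1; 1, 0] : Matrix (Fin 2) (Fin 2) ℤ) i j : ℤ) : R)
      * a i * b j = _
    simp [Fin.sum_univ_two]
  exact (this (fun i => x (Fin.natAdd L.n i)) (fun i => y (Fin.natAdd L.n i))).symm

theorem stab_iff (R : Type*) [CommRing R] (L M : EvenLattice) :
    IsometricOver R (dsum L hyperbolicPlane) (dsum M hyperbolicPlane) ↔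
      Isom (pf (mf R L.B) (hyp R)) (pf (mf R M.B) (hyp R)) := by
  rw [isometricOver_iff]
  exact ⟨fun h => (dsum_iso R L).symm.trans (h.trans (dsum_iso R M)),
    fun h => (dsum_iso R L).trans (h.trans (dsum_iso R M).symm)⟩

theorem isom_iff_mat (R : Type*) [CommRing R] {n m : ℕ} (A : Matrix (Fin n) (Fin n) ℤ)
    (B : Matrix (Fin m) (Fin m) ℤ) : Isom (mf R A) (mf R B) ↔
    ∃ (E : Matrix (Fin m) (Fin n) R) (E' : Matrix (Fin n) (Fin m) R),
      E * E' = 1 ∧ E' * E = 1 ∧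
      E.transpose * B.map (Int.cast : ℤ → R) * E = A.map (Int.cast : ℤ → R) := by
  constructor
  · rintro ⟨e, he⟩
    refine ⟨LinearMap.toMatrix' e.toLinearMap, LinearMap.toMatrix' e.symm.toLinearMap, ?_, ?_, ?_⟩
    · rw [← LinearMap.toMatrix'_comp]; simp
    · rw [← LinearMap.toMatrix'_comp]; simp
    · have h : Matrix.toLinearMap₂' R ((LinearMap.toMatrix' e.toLinearMap).transpose *
          B.map (Int.cast : ℤ → R) * LinearMap.toMatrix' e.toLinearMap) = mf R A := by
        rw [← Matrix.toLinearMap₂'_comp]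
        refine LinearMap.ext fun x => LinearMap.ext fun y => ?_
        simpa [mf] using he x y
      simpa [mf] using congrArg (LinearMap.toMatrix₂' R) h
  · rintro ⟨E, E', h1, h2, h3⟩
    refine ⟨LinearEquiv.ofLinearMap (Matrix.toLin' E) (Matrix.toLin' E') ?_ ?_, fun x y => ?_⟩
    · rw [← Matrix.toLin'_mul, h1, Matrix.toLin'_one]
    · rw [← Matrix.toLin'_mul, h2, Matrix.toLin'_one]
    · unfold mf
      rw [← h3, ← Matrix.toLinearMap₂'_comp]
      rfl

theorem isom_base (R : Type*) [CommRing R] {n m : ℕ} {A : Matrix (Fin n) (Fin n) ℤ}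
    {B : Matrix (Fin m) (Fin m) ℤ} (h : Isom (mf ℤ A) (mf ℤ B)) : Isom (mf R A) (mf R B) := by
  rw [isom_iff_mat] at h ⊢
  obtain ⟨E, E', h1, h2, h3⟩ := h
  refine ⟨E.map (Int.castRingHom R), E'.map (Int.castRingHom R), ?_, ?_, ?_⟩
  · rw [← Matrix.map_mul, h1]; simp
  · rw [← Matrix.map_mul, h2]; simp
  · have : ∀ {k l : ℕ} (X : Matrix (Fin k) (Fin l) ℤ), X.map (Int.cast : ℤ → R) =
      X.map (Int.castRingHom R) := fun X => rfl
    rw [this, this, ← Matrix.transpose_map, ← Matrix.map_mul, ← Matrix.map_mul]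
    congr 1

theorem mf_symm (R : Type*) [CommRing R] (L : EvenLattice) (x y) :
    mf R L.B x y = mf R L.B y x := by
  rw [mf_apply, mf_apply, Matrix.dotProduct_mulVec, ← Matrix.mulVec_transpose, dotProduct_comm,
    ← Matrix.transpose_map, L.symm]

theorem mf_even (R : Type*) [CommRing R] (L : EvenLattice) : EvenForm (mf R L.B) := by
  obtain ⟨K, hK⟩ := even_split_mat L.B L.symm L.even_diag
  intro x
  refine ⟨x ⬝ᵥ (K.map (Int.cast : ℤ → R)).mulVec x, ?_⟩
  have : L.B.map (Int.cast : ℤ → R) = K.map Int.cast + (K.map Int.cast).transpose := by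
    rw [← hK]; ext i j; simp
  rw [mf_apply, this, Matrix.add_mulVec, dotProduct_add, Matrix.mulVec_transpose,
    dotProduct_comm x (Matrix.vecMul _ _), ← Matrix.dotProduct_mulVec]
  ring

theorem genus_of_stable (L M : EvenLattice)
    (h : IsometricOver ℤ (dsum L hyperbolicPlane) (dsum M hyperbolicPlane)) : SameGenus L M := by
  have key : ∀ (R : Type) [CommRing R], IsometricOver R (dsum L hyperbolicPlane)
      (dsum M hyperbolicPlane) := by
    intro R _
    rw [isometricOver_iff] at h ⊢
    exact isom_base R h
  refine ⟨fun p _ => ?_, ?_⟩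
  · rw [isometricOver_iff]
    exact cancel_local (mf_symm _ M) (mf_even _ M) (fun r hr => by simpa using hr)
      ((stab_iff _ L M).1 (key ℤ_[p]))
  · rw [isometricOver_iff]
    exact cancel_local (mf_symm _ M) (mf_even _ M) (fun r hr => by simpa using hr)
      ((stab_iff _ L M).1 (key ℝ))

end transl
end SG


namespace SG

section sat
variable {κ : Type*} [Fintype κ] [DecidableEq κ]

/-- Cast an integral vector. -/
def cv (F : Type*) [Ring F] (w : κ → ℤ) : κ → F := fun k => (w k : F)

theorem clear_den (x : κ → ℚ) : ∃ N : ℤ, N ≠ 0 ∧ ∃ w : κ → ℤ, cv ℚ w = (N : ℚ) • x := by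
  refine ⟨∏ k, ((x k).den : ℤ), Finset.prod_ne_zero_iff.2 fun k _ => by simp, ?_⟩
  have h : ∀ k, ∃ c : ℤ, (∏ k, ((x k).den : ℤ)) = (x k).den * c := fun k =>
    Finset.dvd_prod_of_mem (fun k => ((x k).den : ℤ)) (Finset.mem_univ k)
  choose c hc using h
  refine ⟨fun k => (x k).num * c k, ?_⟩
  funext k
  rw [Pi.smul_apply, hc k]
  simp only [cv, smul_eq_mul]
  push_cast
  rw [← Rat.mul_den_eq_num (x k)]
  ring

theorem sat_aux (I : Submodule ℚ (κ → ℚ)) : ∃ (d : ℕ) (w f : Fin d → (κ → ℤ)),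
    (∀ i, cv ℚ (w i) ∈ I) ∧ (∀ i j, f j ⬝ᵥ w i = if i = j then 1 else 0) ∧
    Module.finrank ℚ I ≤ d := by
  let J : Submodule ℤ (κ → ℤ) :=
    { carrier := {w | cv ℚ w ∈ I}
      add_mem' := by
        intro a b ha hb
        have : cv ℚ (a + b) = cv ℚ a + cv ℚ b := by funext k; simp [cv]
        simpa [this] using I.add_mem ha hb
      zero_mem' := by
        have : cv ℚ (0 : κ → ℤ) = 0 := by funext k; simp [cv]
        simp [this]
      smul_mem' := by
        intro c a ha
        have : cv ℚ (c • a) = (c : ℚ) • cv ℚ a := by funext k; simp [cv]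
        simpa only [Set.mem_setOf_eq, this] using I.smul_mem _ ha }
  have hJ : ∀ w, w ∈ J ↔ cv ℚ w ∈ I := fun w => Iff.rfl
  have tf : Module.IsTorsionFree ℤ ((κ → ℤ) ⧸ J) := by
    refine Module.IsTorsionFree.of_smul_eq_zero fun r m h => ?_
    obtain ⟨m, rfl⟩ := Submodule.mkQ_surjective J m
    by_contra! hne
    apply hne.2
    have h' : J.mkQ (r • m) = 0 := by rw [map_smul]; exact h
    rw [Submodule.mkQ_apply, Submodule.Quotient.mk_eq_zero, hJ] at h' ⊢
    have : cv ℚ (r • m) = (r : ℚ) • cv ℚ m := by funext k; simp [cv]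
    rw [this] at h'
    have hr : (r : ℚ) ≠ 0 := by exact_mod_cast hne.1
    exact (Submodule.smul_mem_iff I hr).1 h'
  obtain ⟨s, hs⟩ := J.mkQ.exists_rightInverse_of_surjective
    (LinearMap.range_eq_top.2 (Submodule.mkQ_surjective J))
  let r : (κ → ℤ) →ₗ[ℤ] J := LinearMap.codRestrict J (LinearMap.id - s ∘ₗ J.mkQ) (by
    intro c
    rw [← Submodule.Quotient.mk_eq_zero, ← Submodule.mkQ_apply]
    have := LinearMap.congr_fun hs (J.mkQ c)
    simp only [LinearMap.comp_apply, LinearMap.id_apply] at this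
    simp only [LinearMap.sub_apply, LinearMap.id_apply, LinearMap.comp_apply, map_sub, this,
      sub_self])
  have hr : ∀ w : J, r w = w := by
    intro w
    apply Subtype.ext
    have : J.mkQ (w : κ → ℤ) = 0 := by simp
    change (w : κ → ℤ) - s (J.mkQ w) = w
    rw [this]; simp
  let b := Module.finBasis ℤ J
  have hdot : ∀ j (v : κ → ℤ), (fun k => b.coord j (r (Pi.single k 1))) ⬝ᵥ v = b.coord j (r v) := by
    intro j v
    have : v = ∑ k, v k • Pi.single k (1 : ℤ) := by simpa using (pi_eq_sum_univ' v)
    conv_rhs => rw [this]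
    simp only [map_sum, map_smul, smul_eq_mul]
    exact Finset.sum_congr rfl fun k _ => mul_comm _ _
  refine ⟨Module.finrank ℤ J, fun i => (b i : κ → ℤ),
    fun j k => b.coord j (r (Pi.single k 1)), fun i => (hJ _).1 (b i).2, ?_, ?_⟩
  · intro i j
    rw [hdot, hr]
    simp [Finsupp.single_apply]
  · have hle : I ≤ Submodule.span ℚ (Set.range fun i => cv ℚ (b i : κ → ℤ)) := by
      intro x hx
      obtain ⟨N, hN, w, hw⟩ := clear_den x
      have hN' : (N : ℚ) ≠ 0 := by exact_mod_cast hN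
      rw [← Submodule.smul_mem_iff _ hN', ← hw]
      have hwJ : w ∈ J := by rw [hJ, hw]; exact I.smul_mem _ hx
      have hsum := b.sum_repr ⟨w, hwJ⟩
      have h2 : cv ℚ w = ∑ i, ((b.repr ⟨w, hwJ⟩ i : ℤ) : ℚ) • cv ℚ (b i : κ → ℤ) := by
        funext k
        have h3 := congrFun (congrArg Subtype.val hsum) k
        simp only [AddSubmonoidClass.coe_finsetSum, SetLike.val_smul, Finset.sum_apply,
          Pi.smul_apply, smul_eq_mul] at h3
        simp only [cv, Finset.sum_apply, Pi.smul_apply, smul_eq_mul]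
        rw [← h3]; push_cast; rfl
      rw [h2]
      exact Submodule.sum_mem _ fun i _ => Submodule.smul_mem _ _
        (Submodule.subset_span ⟨i, rfl⟩)
    have h4 := Submodule.finrank_mono hle
    refine h4.trans ((finrank_range_le_card _).trans ?_)
    simp

/-- Saturated integral bases of rational subspaces. -/
theorem sat (I : Submodule ℚ (κ → ℚ)) (d : ℕ) (hd : d = Module.finrank ℚ I) :
    ∃ (w f : Fin d → (κ → ℤ)),
    (∀ i, cv ℚ (w i) ∈ I) ∧ (∀ i j, f j ⬝ᵥ w i = if i = j then 1 else 0) := by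
  obtain ⟨d', w, f, h1, h2, h3⟩ := sat_aux I
  rw [← hd] at h3
  refine ⟨fun i => w (Fin.castLE h3 i), fun i => f (Fin.castLE h3 i), fun i => h1 _, fun i j => ?_⟩
  rw [h2]
  simp

end sat
end SG


namespace SG

open LinearMap (BilinForm)
open Module (finrank)

section null
variable {F : Type*} [Field F] {V W X Y : Type*} [AddCommGroup V] [Module F V]
  [AddCommGroup W] [Module F W] [AddCommGroup X] [Module F X] [AddCommGroup Y] [Module F Y]

/-- Metabolic forms: existence of a totally isotropic subspace of half dimension. -/
def Null (B : BilinForm F V) : Prop :=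
  ∃ I : Submodule F V, (∀ x ∈ I, ∀ y ∈ I, B x y = 0) ∧ finrank F V ≤ 2 * finrank F I

/-- Nondegeneracy. -/
def ND (B : BilinForm F V) : Prop := ∀ x, (∀ y, B x y = 0) → x = 0

theorem Isom.swap4 (A : BilinForm F V) (B : BilinForm F W) (C : BilinForm F X)
    (D : BilinForm F Y) : Isom (pf (pf A B) (pf C D)) (pf (pf A C) (pf B D)) :=
  ⟨LinearEquiv.prodProdProdComm F V W X Y, fun x y => by
    simp only [pf_apply, LinearEquiv.prodProdProdComm_apply]; ring⟩

theorem neg_pf (A : BilinForm F V) (B : BilinForm F W) : -(pf A B) = pf (-A) (-B) := by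
  refine LinearMap.ext fun x => LinearMap.ext fun y => ?_
  simp only [LinearMap.neg_apply, pf_apply]; ring

theorem Isom.neg {A : BilinForm F V} {B : BilinForm F W} (h : Isom A B) : Isom (-A) (-B) := by
  obtain ⟨e, he⟩ := h
  exact ⟨e, fun x y => by simp [he]⟩

theorem ND.neg {A : BilinForm F V} (h : ND A) : ND (-A) := fun x hx =>
  h x fun y => by simpa using hx y

theorem ND.pf {A : BilinForm F V} {B : BilinForm F W} (hA : ND A) (hB : ND B) : ND (pf A B) := by
  rintro ⟨x, y⟩ h
  have h1 : x = 0 := hA _ fun z => by simpa using h (z, 0)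
  have h2 : y = 0 := hB _ fun z => by simpa using h (0, z)
  simp [h1, h2]

theorem Null.iso {A : BilinForm F V} {B : BilinForm F W} (h : Null A) (hi : Isom A B) :
    Null B := by
  obtain ⟨I, h1, h2⟩ := h
  obtain ⟨e, he⟩ := hi
  refine ⟨I.map e.toLinearMap, ?_, ?_⟩
  · rintro _ ⟨x, hx, rfl⟩ _ ⟨y, hy, rfl⟩
    simpa [he] using h1 x hx y hy
  · rw [← e.finrank_eq, LinearEquiv.finrank_map_eq]
    exact h2

theorem Null.neg {A : BilinForm F V} (h : Null A) : Null (-A) := by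
  obtain ⟨I, h1, h2⟩ := h
  exact ⟨I, fun x hx y hy => by simp [h1 x hx y hy], h2⟩

theorem Null.add [FiniteDimensional F V] [FiniteDimensional F W]
    {A : BilinForm F V} {B : BilinForm F W} (h : Null A) (h' : Null B) :
    Null (pf A B) := by
  obtain ⟨I, h1, h2⟩ := h
  obtain ⟨J, h3, h4⟩ := h'
  refine ⟨LinearMap.range (I.subtype.prodMap J.subtype), ?_, ?_⟩
  · rintro _ ⟨⟨x, y⟩, rfl⟩ _ ⟨⟨x', y'⟩, rfl⟩
    simp [h1 x x.2 x' x'.2, h3 y y.2 y' y'.2]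
  · rw [Module.finrank_prod, LinearMap.finrank_range_of_inj, Module.finrank_prod]
    · omega
    · exact Function.Injective.prodMap I.injective_subtype J.injective_subtype

theorem null_graph [FiniteDimensional F V] [FiniteDimensional F W]
    {A : BilinForm F V} {B : BilinForm F W} (h : Isom A B) : Null (pf A (-B)) := by
  obtain ⟨e, he⟩ := h
  refine ⟨LinearMap.range (LinearMap.id.prod e.toLinearMap), ?_, ?_⟩
  · rintro _ ⟨x, rfl⟩ _ ⟨y, rfl⟩
    simp [he]
  · rw [Module.finrank_prod, ← e.finrank_eq, LinearMap.finrank_range_of_inj]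
    · omega
    · intro x y hxy
      simpa using congrArg Prod.fst hxy

theorem null_cancel [FiniteDimensional F V] [FiniteDimensional F W]
    {A : BilinForm F V} {B : BilinForm F W} (hs : ∀ x y, B x y = B y x) (hB : ND B)
    (h : Null (pf A B)) (h' : Null B) : Null A := by
  obtain ⟨I, h1, h2⟩ := h
  obtain ⟨J, h3, h4⟩ := h'
  have hnd : B.Nondegenerate := by
    refine ⟨fun x hx => hB x hx, fun x hx => hB x fun y => by rw [hs]; exact hx y⟩
  have hle : J ≤ B.orthogonal J := fun x hx => by
    rw [LinearMap.BilinForm.mem_orthogonal_iff]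
    intro y hy
    exact h3 y hy x hx
  have hfo := LinearMap.BilinForm.finrank_orthogonal hnd J
  have hJW : finrank F J ≤ finrank F W := Submodule.finrank_le J
  have hle' := Submodule.finrank_mono hle
  have hJ : J = B.orthogonal J := Submodule.eq_of_le_of_finrank_eq hle (by omega)
  let θ : I →ₗ[F] Module.Dual F J :=
    { toFun := fun u => (B (u : V × W).2) ∘ₗ J.subtype
      map_add' := fun u v => by ext; simp
      map_smul' := fun c u => by ext; simp }
  have hθ : ∀ u j, θ u j = B (u : V × W).2 j := fun _ _ => rfl
  let J0 : Submodule F J := (I.comap (LinearMap.inr F V W)).comap J.subtype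
  have hJ0 : ∀ j : J, j ∈ J0 ↔ ((0, (j : W)) : V × W) ∈ I := fun j => Iff.rfl
  have hr : LinearMap.range θ ≤ J0.dualAnnihilator := by
    rintro _ ⟨u, rfl⟩
    rw [Submodule.mem_dualAnnihilator]
    intro j hj
    have := h1 u u.2 _ ((hJ0 j).1 hj)
    simpa [hθ] using this
  have hrank := θ.finrank_range_add_finrank_ker
  have hrn := Submodule.finrank_mono hr
  have hann := Subspace.finrank_add_finrank_dualAnnihilator_eq J0
  let π : LinearMap.ker θ →ₗ[F] V :=
    (LinearMap.fst F V W) ∘ₗ I.subtype ∘ₗ (LinearMap.ker θ).subtype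
  have hπ : ∀ u, π u = ((u : I) : V × W).1 := fun _ => rfl
  have hmem : ∀ u : LinearMap.ker θ, ((u : I) : V × W).2 ∈ J := by
    intro u
    refine hJ.ge ?_
    rw [LinearMap.BilinForm.mem_orthogonal_iff]
    intro y hy
    have h5 : θ (u : I) = 0 := u.2
    have h6 := LinearMap.congr_fun h5 ⟨y, hy⟩
    change B y _ = 0
    rw [hs]
    exact h6
  have hπr := LinearMap.finrank_range_add_finrank_ker (K := F) (V := LinearMap.ker θ) (V₂ := V) π
  let τ : LinearMap.ker π →ₗ[F] J0 :=
    { toFun := fun u => ⟨⟨((u : LinearMap.ker θ) : I).1.2, hmem _⟩, by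
        rw [hJ0]
        have h7 : π u = 0 := u.2
        rw [hπ] at h7
        have h8 := ((u : LinearMap.ker θ) : I).2
        have h9 : (((u : LinearMap.ker θ) : I) : V × W) = (0, (((u : LinearMap.ker θ) : I) : V × W).2) := by
          ext
          · exact h7
          · rfl
        rw [h9] at h8
        exact h8⟩
      map_add' := fun u v => rfl
      map_smul' := fun c v => rfl }
  have hτ : Function.Injective τ := by
    intro u v huv
    apply Subtype.ext; apply Subtype.ext; apply Subtype.ext
    have h7 : π u = 0 := u.2
    have h7' : π v = 0 := v.2
    rw [hπ] at h7 h7'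
    refine Prod.ext (h7.trans h7'.symm) ?_
    exact congrArg (fun t : J0 => ((t : J) : W)) huv
  have hτr := LinearMap.finrank_le_finrank_of_injective hτ
  refine ⟨LinearMap.range π, ?_, ?_⟩
  · rintro _ ⟨x, rfl⟩ _ ⟨y, rfl⟩
    have h5 := h1 _ (x : I).2 _ (y : I).2
    rw [pf_apply, h3 _ (hmem x) _ (hmem y), add_zero] at h5
    exact h5
  · rw [Module.finrank_prod] at h2
    omega

end null
end SG


namespace SG

open LinearMap (BilinForm)
open Module (finrank)

section witt

/-- Nondegenerate rational quadratic spaces. -/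
structure QS : Type 1 where
  V : Type
  [grp : AddCommGroup V]
  [mod : Module ℚ V]
  [fd : FiniteDimensional ℚ V]
  B : BilinForm ℚ V
  sy : ∀ x y, B x y = B y x
  nd : ND B

attribute [instance] QS.grp QS.mod QS.fd

/-- Orthogonal sum. -/
def QS.plus (A B : QS) : QS :=
  { V := A.V × B.V
    B := pf A.B B.B
    sy := fun x y => by simp only [pf_apply]; rw [A.sy, B.sy]
    nd := A.nd.pf B.nd }

/-- Opposite space. -/
def QS.opp (A : QS) : QS :=
  { V := A.V
    B := -A.B
    sy := fun x y => by simp only [LinearMap.neg_apply]; rw [A.sy]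
    nd := A.nd.neg }

/-- The zero space. -/
def QS.nil : QS :=
  { V := PUnit
    B := 0
    sy := fun _ _ => rfl
    nd := fun _ _ => rfl }

/-- Witt equivalence. -/
def QS.Rel (A B : QS) : Prop := Null (pf A.B (-B.B))

theorem QS.rel_iso {A B : QS} (h : Isom A.B B.B) : A.Rel B := null_graph h

theorem QS.Rel.symm {A B : QS} (h : A.Rel B) : B.Rel A := by
  have h1 : Null (-(pf A.B (-B.B))) := Null.neg h
  rw [neg_pf, neg_neg] at h1
  exact h1.iso (Isom.comm _ _)

theorem QS.null_self (A : QS) : Null (pf (-A.B) A.B) := by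
  have h : Null (pf (-A.B) (- -A.B)) := null_graph (Isom.refl (-A.B))
  rwa [neg_neg] at h

theorem QS.Rel.trans {A B C : QS} (h : A.Rel B) (h' : B.Rel C) : A.Rel C := by
  have h1 : Null (pf (-C.B) B.B) := Null.iso h' (Isom.comm _ _)
  have h2 := (Null.add h h1).iso (Isom.swap4 _ _ _ _)
  exact null_cancel (B.opp.plus B).sy (B.opp.plus B).nd h2 B.null_self

instance witt_setoid : Setoid QS where
  r := QS.Rel
  iseqv := ⟨fun _ => QS.rel_iso (Isom.refl _), fun h => h.symm, fun h h' => h.trans h'⟩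

/-- The Witt group of the rationals. -/
def WG : Type 1 := Quotient witt_setoid

/-- Witt class. -/
def cls (A : QS) : WG := Quotient.mk witt_setoid A

theorem cls_eq {A B : QS} : cls A = cls B ↔ A.Rel B := Quotient.eq

theorem cls_iso {A B : QS} (h : Isom A.B B.B) : cls A = cls B := cls_eq.2 (QS.rel_iso h)

theorem plus_congr (A A' : QS) (h : A.Rel A') (B B' : QS) (h' : B.Rel B') :
    (A.plus B).Rel (A'.plus B') := by
  have h1 := (Null.add h h').iso (Isom.swap4 _ _ _ _)
  rw [← neg_pf] at h1
  exact h1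

theorem opp_congr (A A' : QS) (h : A.Rel A') : A.opp.Rel A'.opp := by
  have h1 : Null (-(pf A.B (-A'.B))) := Null.neg h
  rw [neg_pf] at h1
  exact h1

instance : Add WG := ⟨Quotient.map₂ QS.plus fun A A' h B B' h' => plus_congr A A' h B B' h'⟩
instance : Neg WG := ⟨Quotient.map QS.opp fun A A' h => opp_congr A A' h⟩
instance : Zero WG := ⟨cls QS.nil⟩

theorem cls_plus (A B : QS) : cls (A.plus B) = cls A + cls B := rfl
theorem cls_opp (A : QS) : cls A.opp = - cls A := rfl
theorem cls_nil : cls QS.nil = 0 := rfl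

theorem nil_iso (A : QS) : Isom (QS.nil.plus A).B A.B :=
  ⟨LinearEquiv.ofLinearMap (LinearMap.snd ℚ PUnit A.V) (LinearMap.inr ℚ PUnit A.V) rfl rfl,
    fun x y => by
      change A.B x.2 y.2 = 0 + A.B x.2 y.2
      rw [zero_add]⟩

theorem cls_zero_iff {A : QS} : cls A = 0 ↔ Null A.B := by
  rw [← cls_nil, cls_eq]
  have hi : Isom (pf A.B (-QS.nil.B)) A.B := by
    have h1 : -QS.nil.B = QS.nil.B := neg_zero
    rw [h1]
    exact (Isom.comm _ _).trans (nil_iso A)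
  exact ⟨fun h => Null.iso h hi, fun h => Null.iso h hi.symm⟩

theorem cls_ind {P : WG → Prop} (h : ∀ A, P (cls A)) (x : WG) : P x := Quotient.ind h x

theorem wg_add_assoc (x y z : WG) : x + y + z = x + (y + z) := by
  induction x using cls_ind; induction y using cls_ind; induction z using cls_ind
  exact cls_iso (Isom.assoc _ _ _)

theorem wg_add_comm (x y : WG) : x + y = y + x := by
  induction x using cls_ind; induction y using cls_ind
  exact cls_iso (Isom.comm _ _)

theorem wg_zero_add (x : WG) : 0 + x = x := by
  induction x using cls_ind
  exact cls_iso (nil_iso _)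

theorem wg_neg_add (x : WG) : -x + x = 0 := by
  induction x using cls_ind with
  | h A => exact cls_zero_iff.2 A.null_self

instance : AddCommGroup WG where
  add_assoc := wg_add_assoc
  zero_add := wg_zero_add
  add_zero x := by rw [wg_add_comm]; exact wg_zero_add x
  neg_add_cancel := wg_neg_add
  add_comm := wg_add_comm
  nsmul := nsmulRec
  zsmul := zsmulRec

/-- One-dimensional form. -/
def one (r : ℚ) : BilinForm ℚ ℚ := r • LinearMap.mul ℚ ℚ

theorem one_apply (r x y : ℚ) : one r x y = r * (x * y) := rfl

/-- One-dimensional space. -/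
def oneS (r : ℚ) (hr : r ≠ 0) : QS :=
  { V := ℚ
    B := one r
    sy := fun x y => by rw [one_apply, one_apply]; ring
    nd := fun x h => by
      have := h 1
      rw [one_apply] at this
      simpa [hr] using this }

open Classical in
/-- Class of a one-dimensional space. -/
def g (r : ℚ) : WG := if hr : r ≠ 0 then cls (oneS r hr) else 0

theorem g_ne {r : ℚ} (hr : r ≠ 0) : g r = cls (oneS r hr) := dif_pos hr

theorem g_zero : g 0 = 0 := dif_neg (by simp)

theorem g_sq (r s : ℚ) (hs : s ≠ 0) : g (r * s ^ 2) = g r := by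
  by_cases hr : r = 0
  · simp [hr]
  · rw [g_ne hr, g_ne (by positivity)]
    have h : Isom (one (r * s ^ 2)) (one r) :=
      ⟨LinearEquiv.smulOfNeZero ℚ ℚ s hs, fun x y => by
        change r * ((s * x) * (s * y)) = r * s ^ 2 * (x * y)
        ring⟩
    exact cls_iso h

theorem g_neg (r : ℚ) : g (-r) = - g r := by
  by_cases hr : r = 0
  · simp [hr, g_zero]
  · rw [g_ne hr, g_ne (by simpa using hr), ← cls_opp]
    have h : Isom (one (-r)) (-one r) := ⟨LinearEquiv.refl ℚ ℚ, fun x y => by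
      change -(r * (x * y)) = -r * (x * y)
      ring⟩
    exact cls_iso h

theorem g_add (r s : ℚ) (hr : r ≠ 0) (hs : s ≠ 0) (h : r + s ≠ 0) :
    g r + g s = g (r + s) + g (r * s * (r + s)) := by
  rw [g_ne hr, g_ne hs, g_ne h, g_ne (by positivity), ← cls_plus, ← cls_plus]
  symm
  let f : (ℚ × ℚ) →ₗ[ℚ] (ℚ × ℚ) :=
    { toFun := fun u => (u.1 + s * u.2, u.1 - r * u.2)
      map_add' := fun u v => by ext <;> simp <;> ring
      map_smul' := fun c v => by ext <;> simp <;> ring }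
  let f' : (ℚ × ℚ) →ₗ[ℚ] (ℚ × ℚ) :=
    { toFun := fun u => ((r * u.1 + s * u.2) / (r + s), (u.1 - u.2) / (r + s))
      map_add' := fun u v => by ext <;> simp <;> ring
      map_smul' := fun c v => by ext <;> simp <;> ring }
  have hi : Isom (pf (one (r + s)) (one (r * s * (r + s)))) (pf (one r) (one s)) := by
    refine ⟨LinearEquiv.ofLinearMap f f' ?_ ?_, fun x y => ?_⟩
    · refine LinearMap.ext fun u => ?_
      change ((r * u.1 + s * u.2) / (r + s) + s * ((u.1 - u.2) / (r + s)),
        (r * u.1 + s * u.2) / (r + s) - r * ((u.1 - u.2) / (r + s))) = u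
      ext <;> simp only <;> field_simp <;> ring
    · refine LinearMap.ext fun u => ?_
      change ((r * (u.1 + s * u.2) + s * (u.1 - r * u.2)) / (r + s),
        ((u.1 + s * u.2) - (u.1 - r * u.2)) / (r + s)) = u
      ext <;> simp only <;> field_simp <;> ring
    · obtain ⟨x1, x2⟩ := x
      obtain ⟨y1, y2⟩ := y
      change r * ((x1 + s * x2) * (y1 + s * y2)) + s * ((x1 - r * x2) * (y1 - r * y2)) =
        (r + s) * (x1 * y1) + (r * s * (r + s)) * (x2 * y2)
      ring
  exact cls_iso hi

/-- Diagonal forms. -/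
def dq {k : ℕ} (a : Fin k → ℚ) : BilinForm ℚ (Fin k → ℚ) :=
  Matrix.toLinearMap₂' ℚ (Matrix.diagonal a)

theorem dq_apply {k : ℕ} (a x y : Fin k → ℚ) : dq a x y = ∑ i, a i * (x i * y i) := by
  rw [dq, Matrix.toLinearMap₂'_apply']
  simp only [dotProduct, Matrix.mulVec_diagonal]
  exact Finset.sum_congr rfl fun i _ => by ring

/-- Diagonal spaces. -/
def dqS {k : ℕ} (a : Fin k → ℚ) (ha : ∀ i, a i ≠ 0) : QS :=
  { V := Fin k → ℚ
    B := dq a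
    sy := fun x y => by
      rw [dq_apply, dq_apply]; exact Finset.sum_congr rfl fun i _ => by ring
    nd := fun x h => by
      funext i
      have := h (Pi.single i 1)
      rw [dq_apply, Finset.sum_eq_single i] at this
      · simpa [ha i] using this
      · intro j _ hj; simp [hj]
      · simp }

theorem cls_dq {k : ℕ} (a : Fin k → ℚ) (ha : ∀ i, a i ≠ 0) :
    cls (dqS a ha) = ∑ i, g (a i) := by
  induction k with
  | zero =>
    simp only [Finset.univ_eq_empty, Finset.sum_empty]
    rw [cls_zero_iff]
    refine ⟨⊥, by simp, ?_⟩
    change finrank ℚ (Fin 0 → ℚ) ≤ _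
    simp
  | succ k ih =>
    rw [Fin.sum_univ_succ, ← ih (fun i => a i.succ) (fun i => ha _), g_ne (ha 0), ← cls_plus]
    symm
    suffices h : Isom (pf (one (a 0)) (dq (fun i => a i.succ))) (dq a) from cls_iso h
    refine ⟨Fin.consLinearEquiv ℚ (fun _ : Fin (k + 1) => ℚ), fun x y => ?_⟩
    obtain ⟨x1, x2⟩ := x
    obtain ⟨y1, y2⟩ := y
    change dq a (Fin.cons x1 x2) (Fin.cons y1 y2) = one (a 0) x1 y1 + dq (fun i => a i.succ) x2 y2
    rw [dq_apply, dq_apply, Fin.sum_univ_succ, one_apply]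
    simp

theorem cls_diag (A : QS) : ∃ (k : ℕ) (a : Fin k → ℚ), (∀ i, a i ≠ 0) ∧
    cls A = ∑ i, g (a i) := by
  have : Invertible (2 : ℚ) := invertibleOfNonzero (by norm_num)
  obtain ⟨v, hv⟩ := LinearMap.BilinForm.exists_orthogonal_basis (B := A.B)
    ⟨fun x y => by simpa using A.sy x y⟩
  have hB : ∀ x y : Fin (finrank ℚ A.V) → ℚ, A.B (v.equivFun.symm x) (v.equivFun.symm y) =
      ∑ i, A.B (v i) (v i) * (x i * y i) := by
    intro x y
    rw [Module.Basis.equivFun_symm_apply, Module.Basis.equivFun_symm_apply]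
    simp only [map_sum, LinearMap.sum_apply, map_smul, LinearMap.smul_apply, smul_eq_mul,
      Finset.mul_sum]
    refine Finset.sum_congr rfl fun i _ => ?_
    rw [Finset.sum_eq_single i]
    · ring
    · intro j _ hj
      have : A.B (v j) (v i) = 0 := hv hj
      rw [this]; ring
    · simp
  have hne : ∀ i, A.B (v i) (v i) ≠ 0 := by
    intro i h
    have : v i = 0 := A.nd _ fun y => by
      have h1 := hB (Pi.single i 1) (v.equivFun y)
      rw [LinearEquiv.symm_apply_apply] at h1
      have h2 : v.equivFun.symm (Pi.single i 1) = v i := by simp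
      rw [h2] at h1
      rw [h1]
      refine Finset.sum_eq_zero fun j _ => ?_
      by_cases hj : j = i
      · subst hj; simp [h]
      · simp [hj]
    exact v.ne_zero i this
  refine ⟨_, fun i => A.B (v i) (v i), hne, ?_⟩
  rw [← cls_dq _ hne]
  symm
  have h : Isom (dq fun i => A.B (v i) (v i)) A.B :=
    ⟨v.equivFun.symm, fun x y => by rw [hB, dq_apply]⟩
  exact cls_iso h

end witt
end SG


namespace SG

section mt

/-- Integers all of whose prime factors are less than `m`. -/
def Sm (m : ℕ) (a : ℤ) : Prop := a ≠ 0 ∧ ∀ q : ℕ, q.Prime → (q : ℤ) ∣ a → q < m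

theorem Sm.mul {m : ℕ} {a b : ℤ} (ha : Sm m a) (hb : Sm m b) : Sm m (a * b) :=
  ⟨mul_ne_zero ha.1 hb.1, fun q hq h => by
    rcases (Nat.prime_iff_prime_int.1 hq).dvd_or_dvd h with h | h
    · exact ha.2 q hq h
    · exact hb.2 q hq h⟩

theorem Sm.neg {m : ℕ} {a : ℤ} (ha : Sm m a) : Sm m (-a) :=
  ⟨neg_ne_zero.2 ha.1, fun q hq h => ha.2 q hq (by simpa using h)⟩

theorem Sm.of_lt {m : ℕ} {a : ℤ} (h0 : a ≠ 0) (h : |a| < m) : Sm m a :=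
  ⟨h0, fun q _ hd => by
    have := Int.le_of_dvd (abs_pos.2 h0) ((dvd_abs _ _).2 hd)
    omega⟩

theorem Sm.not_dvd {p : ℕ} [hp : Fact p.Prime] {a : ℤ} (h : Sm p a) : (a : ZMod p) ≠ 0 := by
  intro h0
  rw [ZMod.intCast_zmod_eq_zero_iff_dvd] at h0
  exact lt_irrefl _ (h.2 p hp.out h0)

theorem solve_quad_two : ∀ x y z : ZMod 2, x ≠ 0 → y ≠ 0 → z ≠ 0 →
    ∃ α β : ZMod 2, x * α ^ 2 + y * β ^ 2 = -z := by decide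

/-- Axioms for symbols. -/
structure GS (p : ℕ) {G : Type*} [AddCommGroup G] (γ : ℤ → G) : Prop where
  sq : ∀ r s, s ≠ 0 → γ (r * s ^ 2) = γ r
  neg : ∀ r, γ (-r) = -γ r
  add : ∀ r s, r ≠ 0 → s ≠ 0 → r + s ≠ 0 → γ r + γ s = γ (r + s) + γ (r * s * (r + s))
  sm : ∀ a, Sm p a → γ a = 0

variable {p : ℕ} [hp : Fact p.Prime] {G : Type*} [AddCommGroup G] {γ : ℤ → G}

theorem GS.key (h : GS p γ) {a u v k : ℤ} (ha : Sm p a) (hu : Sm p u) (hv : Sm p v)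
    (hk : k = 0 ∨ Sm p k) (e : u = v + k * p) : γ (p * (a * u)) = γ (p * (a * v)) := by
  rcases hk with rfl | hk
  · simp [e]
  · have hp0 : (p : ℤ) ≠ 0 := by exact_mod_cast hp.out.ne_zero
    have h1 := h.add (p * (a * v)) (a * k * (p : ℤ) ^ 2)
      (mul_ne_zero hp0 (ha.mul hv).1)
      (mul_ne_zero (ha.mul hk).1 (pow_ne_zero _ hp0))
      (by
        have : (p : ℤ) * (a * v) + a * k * (p : ℤ) ^ 2 = p * (a * u) := by rw [e]; ring
        rw [this]; exact mul_ne_zero hp0 (ha.mul hu).1)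
    have e1 : (p : ℤ) * (a * v) + a * k * (p : ℤ) ^ 2 = p * (a * u) := by rw [e]; ring
    have e2 : (p : ℤ) * (a * v) * (a * k * (p : ℤ) ^ 2) * (p * (a * u)) =
      (a * v * k * u) * ((p : ℤ) ^ 2 * a) ^ 2 := by ring
    rw [e1, e2, h.sq _ _ hp0, h.sq _ _ (mul_ne_zero (pow_ne_zero _ hp0) ha.1),
      h.sm _ (ha.mul hk), h.sm _ (((ha.mul hv).mul hk).mul hu), add_zero, add_zero] at h1
    exact h1.symm

/-- Symbols indexed by residues. -/
def Tt (p : ℕ) {G : Type*} (γ : ℤ → G) (x : ZMod p) : G := γ (p * x.valMinAbs)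

theorem vma_bound (x : ZMod p) : 2 * |x.valMinAbs| ≤ p := by
  have := ZMod.valMinAbs_mem_Ioc x
  rw [abs_eq_max_neg]
  rcases this with ⟨h1, h2⟩
  omega

theorem vma_ne {x : ZMod p} (hx : x ≠ 0) : x.valMinAbs ≠ 0 := by
  simpa using hx

theorem vma_sm {x : ZMod p} (hx : x ≠ 0) : Sm p x.valMinAbs := by
  refine Sm.of_lt (vma_ne hx) ?_
  have := vma_bound x
  have := hp.out.pos
  have := abs_nonneg x.valMinAbs
  omega

theorem GS.step (h : GS p γ) {a q c : ℤ} (ha : Sm p a) (hq : Sm p q) (hq' : |q| < p)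
    (hc : c ≠ 0) (hc' : |c| < p) :
    γ (p * (a * (q * c))) = γ (p * (a * ((q * c : ℤ) : ZMod p).valMinAbs)) := by
  have hcs : Sm p c := Sm.of_lt hc hc'
  have hne := (hq.mul hcs).not_dvd
  set c' := ((q * c : ℤ) : ZMod p).valMinAbs with hc''
  have h1 : ((q * c - c' : ℤ) : ZMod p) = 0 := by
    rw [Int.cast_sub, hc'', ZMod.coe_valMinAbs, sub_self]
  rw [ZMod.intCast_zmod_eq_zero_iff_dvd] at h1
  obtain ⟨k, hk⟩ := h1
  refine h.key (k := k) ha (hq.mul hcs) (vma_sm hne) ?_ (by rw [mul_comm k, ← hk]; ring)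
  by_cases hk0 : k = 0
  · exact Or.inl hk0
  · refine Or.inr (Sm.of_lt hk0 ?_)
    have hb := vma_bound ((q * c : ℤ) : ZMod p)
    rw [← hc''] at hb
    have hpp : (2 : ℤ) ≤ p := by exact_mod_cast hp.out.two_le
    have h2 : (p : ℤ) * |k| ≤ |q| * |c| + |c'| := by
      have : |(p : ℤ) * k| = p * |k| := by rw [abs_mul, Nat.abs_cast]
      rw [← this, ← hk, ← abs_mul]
      exact abs_sub _ _
    have h3 : |q| * |c| ≤ (p - 1) * (p - 1) :=
      mul_le_mul (by omega) (by omega) (abs_nonneg _) (by omega)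
    by_contra hcon
    push Not at hcon
    nlinarith

theorem GS.lift_aux (h : GS p γ) (a : ℕ) : Sm p a → ∀ c : ℤ, c ≠ 0 → |c| < p →
    γ (p * (a * c)) = Tt p γ ((a * c : ℤ) : ZMod p) := by
  have hpp : (2 : ℤ) ≤ p := by exact_mod_cast hp.out.two_le
  have h1 : Sm p 1 := Sm.of_lt one_ne_zero (by simp; omega)
  induction a using induction_on_primes with
  | zero => intro ha; exact absurd rfl ha.1
  | one =>
    intro _ c hc hc'
    have := h.step h1 h1 (by simp; omega) hc hc'
    simpa [Tt] using this
  | prime_mul q a hq ih =>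
    intro hqa c hc hc'
    have ha : Sm p a := by
      refine ⟨fun h0 => hqa.1 (by push_cast; simp [h0]), fun r hr hd => hqa.2 r hr ?_⟩
      push_cast
      exact dvd_mul_of_dvd_right hd _
    have hqp : q < p := hqa.2 q hq (by push_cast; exact dvd_mul_right _ _)
    have hqs : Sm p (q : ℤ) := Sm.of_lt (by exact_mod_cast hq.ne_zero) (by simpa using hqp)
    have h2 := h.step ha hqs (by simpa using hqp) hc hc'
    have hne := (hqs.mul (Sm.of_lt hc hc')).not_dvd
    have e1 : ((q * a : ℕ) : ℤ) * c = a * (q * c) := by push_cast; ring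
    have hb := vma_sm hne
    have hb' := vma_bound ((q * c : ℤ) : ZMod p)
    rw [e1, h2, ih ha _ hb.1 (by have := abs_nonneg (((q * c : ℤ) : ZMod p).valMinAbs); omega)]
    congr 1
    push_cast [ZMod.coe_valMinAbs]
    rfl

theorem GS.lift (h : GS p γ) {u : ℤ} (hu : Sm p u) : γ (p * u) = Tt p γ (u : ZMod p) := by
  have hpp : (2 : ℤ) ≤ p := by exact_mod_cast hp.out.two_le
  have h1 : Sm p (u.natAbs : ℤ) := by
    rcases Int.natAbs_eq u with h | h
    · rwa [← h]
    · have := hu.neg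
      rw [h] at this
      simpa using this
  have h2 := h.lift_aux u.natAbs h1
  rcases Int.natAbs_eq u with h3 | h3
  · have := h2 1 one_ne_zero (by simp; omega)
    rwa [mul_one, ← h3] at this
  · have := h2 (-1) (by simp) (by simp; omega)
    rwa [mul_neg_one, ← h3] at this

theorem GS.T_sq (h : GS p γ) {x w : ZMod p} (hx : x ≠ 0) (hw : w ≠ 0) :
    Tt p γ (x * w ^ 2) = Tt p γ x := by
  have h1 := h.lift ((vma_sm hx).mul ((vma_sm hw).mul (vma_sm hw)))
  push_cast [ZMod.coe_valMinAbs] at h1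
  rw [pow_two, ← h1, ← pow_two, ← mul_assoc, h.sq _ _ (vma_ne hw)]
  rfl

theorem GS.T_neg (h : GS p γ) {x : ZMod p} (hx : x ≠ 0) : Tt p γ (-x) = -Tt p γ x := by
  have h1 := h.lift (vma_sm hx).neg
  push_cast [ZMod.coe_valMinAbs] at h1
  rw [← h1, mul_neg, h.neg]
  rfl

theorem GS.T_add (h : GS p γ) {x y : ZMod p} (hx : x ≠ 0) (hy : y ≠ 0) (hxy : x + y ≠ 0) :
    Tt p γ x + Tt p γ y = Tt p γ (x + y) + Tt p γ (x * y * (x + y)) := by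
  have hp0 : (p : ℤ) ≠ 0 := by exact_mod_cast hp.out.ne_zero
  have hne : x.valMinAbs + y.valMinAbs ≠ 0 := by
    intro h0
    have := congrArg (Int.cast : ℤ → ZMod p) h0
    push_cast [ZMod.coe_valMinAbs] at this
    exact hxy this
  have hlt : |x.valMinAbs + y.valMinAbs| < p := by
    have h1 := vma_bound x
    have h2 := vma_bound y
    have h3 := abs_add_le x.valMinAbs y.valMinAbs
    refine lt_of_le_of_ne (by omega) fun h4 => ?_
    have h5 : (p : ℤ) ∣ x.valMinAbs + y.valMinAbs := by
      rw [← dvd_abs, h4]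
    rw [← ZMod.intCast_zmod_eq_zero_iff_dvd] at h5
    push_cast [ZMod.coe_valMinAbs] at h5
    exact hxy h5
  have hs := Sm.of_lt hne hlt
  have h1 := h.lift hs
  have h2 := h.lift (((vma_sm hx).mul (vma_sm hy)).mul hs)
  push_cast [ZMod.coe_valMinAbs] at h1 h2
  rw [← h1, ← h2]
  have h3 := h.add (p * x.valMinAbs) (p * y.valMinAbs) (mul_ne_zero hp0 (vma_ne hx))
    (mul_ne_zero hp0 (vma_ne hy)) (by rw [← mul_add]; exact mul_ne_zero hp0 hne)
  rw [← mul_add] at h3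
  rw [← h.sq (p * (x.valMinAbs * y.valMinAbs * (x.valMinAbs + y.valMinAbs))) p hp0]
  have e : (p : ℤ) * x.valMinAbs * (p * y.valMinAbs) * (p * (x.valMinAbs + y.valMinAbs)) =
    p * (x.valMinAbs * y.valMinAbs * (x.valMinAbs + y.valMinAbs)) * p ^ 2 := by ring
  rw [e] at h3
  exact h3

theorem solve_quad {x y z : ZMod p} (hx : x ≠ 0) (hy : y ≠ 0) (hz : z ≠ 0) :
    ∃ α β : ZMod p, x * α ^ 2 + y * β ^ 2 = -z := by
  rcases hp.out.eq_two_or_odd with h2 | h2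
  · subst h2
    exact solve_quad_two x y z hx hy hz
  · have h := FiniteField.exists_root_sum_quadratic (R := ZMod p)
      (f := Polynomial.C x * Polynomial.X ^ 2)
      (g := Polynomial.C y * Polynomial.X ^ 2 + Polynomial.C z)
      (Polynomial.degree_C_mul_X_pow 2 hx)
      (by
        rw [Polynomial.degree_add_eq_left_of_degree_lt]
        · exact Polynomial.degree_C_mul_X_pow 2 hy
        · rw [Polynomial.degree_C_mul_X_pow 2 hy]
          exact Polynomial.degree_C_le.trans_lt (by norm_num))
      (by rw [ZMod.card]; exact h2)
    obtain ⟨a, b, hab⟩ := h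
    refine ⟨a, b, ?_⟩
    simp at hab
    linear_combination hab

theorem GS.T_three (h : GS p γ) {x y z : ZMod p} (hx : x ≠ 0) (hy : y ≠ 0) (hz : z ≠ 0) :
    ∃ w : ZMod p, w ≠ 0 ∧ Tt p γ x + Tt p γ y + Tt p γ z = Tt p γ w := by
  obtain ⟨α, β, hab⟩ := solve_quad hx hy hz
  have hnz : -z ≠ 0 := neg_ne_zero.2 hz
  by_cases hα : α = 0
  · have hβ : β ≠ 0 := by rintro rfl; simp [hα] at hab; exact hz hab
    refine ⟨x, hx, ?_⟩
    have h1 : y * β ^ 2 = -z := by rw [← hab, hα]; ring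
    have h2 := h.T_sq hy hβ
    rw [h1, h.T_neg hz] at h2
    rw [← h2]; abel
  · by_cases hβ : β = 0
    · refine ⟨y, hy, ?_⟩
      have h1 : x * α ^ 2 = -z := by rw [← hab, hβ]; ring
      have h2 := h.T_sq hx hα
      rw [h1, h.T_neg hz] at h2
      rw [← h2]; abel
    · have h3 := h.T_add (mul_ne_zero hx (pow_ne_zero 2 hα)) (mul_ne_zero hy (pow_ne_zero 2 hβ))
        (by rw [hab]; exact hnz)
      rw [h.T_sq hx hα, h.T_sq hy hβ, hab, h.T_neg hz] at h3
      refine ⟨_, ?_, by rw [h3, add_comm (-Tt p γ z), add_assoc, neg_add_cancel, add_zero]⟩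
      exact mul_ne_zero (mul_ne_zero (mul_ne_zero hx (pow_ne_zero 2 hα))
        (mul_ne_zero hy (pow_ne_zero 2 hβ))) hnz

/-- Elements of length at most two. -/
def Short (p : ℕ) {G : Type*} [AddCommGroup G] (γ : ℤ → G) (e : G) : Prop :=
  e = 0 ∨ (∃ x : ZMod p, x ≠ 0 ∧ e = Tt p γ x) ∨
    ∃ x y : ZMod p, x ≠ 0 ∧ y ≠ 0 ∧ e = Tt p γ x + Tt p γ y

theorem GS.short_addT (h : GS p γ) {e : G} (he : Short p γ e) {z : ZMod p} (hz : z ≠ 0) :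
    Short p γ (e + Tt p γ z) := by
  rcases he with rfl | ⟨x, hx, rfl⟩ | ⟨x, y, hx, hy, rfl⟩
  · exact Or.inr (Or.inl ⟨z, hz, zero_add _⟩)
  · exact Or.inr (Or.inr ⟨x, z, hx, hz, rfl⟩)
  · exact Or.inr (Or.inl (h.T_three hx hy hz))

theorem GS.short_add (h : GS p γ) {e e' : G} (he : Short p γ e) (he' : Short p γ e') :
    Short p γ (e + e') := by
  rcases he' with rfl | ⟨x, hx, rfl⟩ | ⟨x, y, hx, hy, rfl⟩
  · simpa using he
  · exact h.short_addT he hx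
  · rw [← add_assoc]
    exact h.short_addT (h.short_addT he hx) hy

theorem GS.short_neg (h : GS p γ) {e : G} (he : Short p γ e) : Short p γ (-e) := by
  rcases he with rfl | ⟨x, hx, rfl⟩ | ⟨x, y, hx, hy, rfl⟩
  · exact Or.inl neg_zero
  · exact Or.inr (Or.inl ⟨-x, neg_ne_zero.2 hx, (h.T_neg hx).symm⟩)
  · exact Or.inr (Or.inr ⟨-x, -y, neg_ne_zero.2 hx, neg_ne_zero.2 hy, by
      rw [h.T_neg hx, h.T_neg hy]; abel⟩)

theorem GS.short_gen (h : GS p γ) {a : ℤ} (ha : Sm (p + 1) a) : Short p γ (γ a) := by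
  have hp0 : (p : ℤ) ≠ 0 := by exact_mod_cast hp.out.ne_zero
  have hfin : FiniteMultiplicity (p : ℤ) a :=
    Int.finiteMultiplicity_iff.2 ⟨by simpa using hp.out.one_lt.ne', ha.1⟩
  obtain ⟨b, hb, hnb⟩ := hfin.exists_eq_pow_mul_and_not_dvd
  set e := multiplicity (p : ℤ) a
  have hbs : Sm p b := by
    refine ⟨fun h0 => hnb (by simp [h0]), fun q hq hd => ?_⟩
    have h1 := ha.2 q hq (by rw [hb]; exact dvd_mul_of_dvd_right hd _)
    refine lt_of_le_of_ne (by omega) ?_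
    rintro rfl
    exact hnb hd
  rcases Nat.even_or_odd' e with ⟨k, hk | hk⟩
  · left
    have : a = b * ((p : ℤ) ^ k) ^ 2 := by rw [hb, hk]; ring
    rw [this, h.sq _ _ (pow_ne_zero _ hp0), h.sm _ hbs]
  · right; left
    refine ⟨b, hbs.not_dvd, ?_⟩
    have : a = p * b * ((p : ℤ) ^ k) ^ 2 := by rw [hb, hk]; ring
    rw [this, h.sq _ _ (pow_ne_zero _ hp0), h.lift hbs]

theorem GS.two_zero (h : GS p γ) {x y : ZMod p} (hx : x ≠ 0) (hy : y ≠ 0) (s t : ZMod p)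
    (hst : s ≠ 0 ∨ t ≠ 0) (e : x * s ^ 2 + y * t ^ 2 = 0) : Tt p γ x + Tt p γ y = 0 := by
  have hs : s ≠ 0 := by
    rintro rfl
    have : t ≠ 0 := by simpa using hst
    simp [hy, this] at e
  have ht : t ≠ 0 := by
    rintro rfl
    simp [hx, hs] at e
  rw [← h.T_sq hx hs, ← h.T_sq hy ht, eq_neg_of_add_eq_zero_left e,
    h.T_neg (mul_ne_zero hy (pow_ne_zero 2 ht)), neg_add_cancel]

end mt
end SG


namespace SG

open LinearMap (BilinForm)
open Module (finrank)

section lemP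
variable {A S : Type} [Fintype A] [Fintype S] [DecidableEq A] [DecidableEq S]

theorem mf_cv (R : Type*) [CommRing R] (U : Matrix A A ℤ) (w v : A → ℤ) :
    mf R U (cv R w) (cv R v) = ((mf ℤ U w v : ℤ) : R) := by
  rw [mf_apply, mf_apply]
  simp only [dotProduct, Matrix.mulVec, cv, Matrix.map_apply]
  push_cast
  rfl

theorem mf_blocks (R : Type*) [CommRing R] (U : Matrix A A ℤ) (D : Matrix S S ℤ)
    (x y : A ⊕ S → R) : mf R (Matrix.fromBlocks U 0 0 D) x y =
      mf R U (fun a => x (Sum.inl a)) (fun a => y (Sum.inl a)) +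
      mf R D (fun a => x (Sum.inr a)) (fun a => y (Sum.inr a)) := by
  simp [mf_apply, dotProduct, Matrix.mulVec]

theorem mf_sum (R : Type*) [CommRing R] (U : Matrix A A ℤ) (D : Matrix S S ℤ) :
    Isom (mf R (Matrix.fromBlocks U 0 0 D)) (pf (mf R U) (mf R D)) :=
  ⟨LinearEquiv.sumArrowLequivProdArrow A S R R, fun x y => by rw [mf_blocks]; rfl⟩

theorem mf_diag (R : Type*) [CommRing R] (b : S → ℤ) (x y : S → R) :
    mf R (Matrix.diagonal b) x y = ∑ i, (b i : R) * (x i * y i) := by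
  rw [mf_apply, Matrix.diagonal_map (by simp)]
  simp only [dotProduct, Matrix.mulVec_diagonal]
  exact Finset.sum_congr rfl fun i _ => by ring

theorem isotropic_rank {F : Type*} [Field F] (U : Matrix A A ℤ)
    (hU : ((U.det : ℤ) : F) ≠ 0) (E : Submodule F (A → F))
    (hE : ∀ x ∈ E, ∀ y ∈ E, mf F U x y = 0) : 2 * finrank F E ≤ Fintype.card A := by
  have hnd : (mf F U).Nondegenerate := by
    apply LinearMap.nondegenerate_toLinearMap₂'_of_det_ne_zero'
    have : (U.map (Int.cast : ℤ → F)).det = ((U.det : ℤ) : F) := by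
      have := (Int.castRingHom F).map_det U
      simp only [RingHom.mapMatrix_apply] at this
      exact this.symm
    rwa [this]
  have hle : E ≤ (mf F U).orthogonal E := fun x hx => by
    rw [LinearMap.BilinForm.mem_orthogonal_iff]
    intro y hy
    exact hE y hy x hx
  have h1 := Submodule.finrank_mono hle
  rw [LinearMap.BilinForm.finrank_orthogonal hnd, Module.finrank_fintype_fun_eq_card] at h1
  have h2 := Submodule.finrank_le E
  rw [Module.finrank_fintype_fun_eq_card] at h2
  omega

theorem lemma_P (p : ℕ) [hp : Fact p.Prime] (U : Matrix A A ℤ) (hU : ((U.det : ℤ) : ZMod p) ≠ 0)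
    (b : S → ℤ) [Nonempty S]
    (hN : Null (mf ℚ (Matrix.fromBlocks U 0 0 (Matrix.diagonal fun i => p * b i)))) :
    ∃ x : S → ℤ, (∃ i, (x i : ZMod p) ≠ 0) ∧ ∑ i, (b i : ZMod p) * (x i : ZMod p) ^ 2 = 0 := by
  obtain ⟨I, hI, hd⟩ := hN
  obtain ⟨d, hd0⟩ : ∃ d, d = finrank ℚ I := ⟨_, rfl⟩
  obtain ⟨w, f, hw, hf⟩ := sat I d hd0
  rw [Module.finrank_fintype_fun_eq_card, Fintype.card_sum, ← hd0] at hd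
  have hp0 : (p : ℤ) ≠ 0 := by exact_mod_cast hp.out.ne_zero
  have hww : ∀ i j, mf ℤ (Matrix.fromBlocks U 0 0 (Matrix.diagonal fun i => p * b i))
      (w i) (w j) = 0 := by
    intro i j
    have := hI _ (hw i) _ (hw j)
    rw [mf_cv] at this
    exact_mod_cast this
  let v : Fin d → A → ZMod p := fun i a => (w i (Sum.inl a) : ZMod p)
  have hvv : ∀ i j, mf (ZMod p) U (v i) (v j) = 0 := by
    intro i j
    have h1 := mf_cv (ZMod p) (Matrix.fromBlocks U 0 0 (Matrix.diagonal fun i => p * b i))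
      (w i) (w j)
    rw [hww, mf_blocks, mf_diag] at h1
    simpa [cv] using h1
  let Φ := Fintype.linearCombination (ZMod p) v
  have hΦ : ∀ c, Φ c = ∑ i, c i • v i := fun c => Fintype.linearCombination_apply _ _ _
  have hr := isotropic_rank (F := ZMod p) U hU (LinearMap.range Φ) (by
    rintro _ ⟨x, rfl⟩ _ ⟨y, rfl⟩
    rw [hΦ, hΦ]
    simp only [map_sum, LinearMap.sum_apply, map_smul, LinearMap.smul_apply, hvv, smul_zero,
      Finset.sum_const_zero])
  have hrk := Φ.finrank_range_add_finrank_ker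
  rw [Module.finrank_fintype_fun_eq_card, Fintype.card_fin] at hrk
  have hS : 0 < Fintype.card S := Fintype.card_pos
  have hker : 0 < finrank (ZMod p) (LinearMap.ker Φ) := by omega
  have := Module.finrank_pos_iff.1 hker
  obtain ⟨c, hc⟩ := exists_ne (0 : LinearMap.ker Φ)
  have hcker : Φ c = 0 := c.2
  obtain ⟨j, hj⟩ : ∃ j, (c : Fin d → ZMod p) j ≠ 0 := by
    by_contra! h
    exact hc (Subtype.ext (funext h))
  let cc : Fin d → ℤ := fun i => ((c : Fin d → ZMod p) i).valMinAbs
  have hcc : ∀ i, (cc i : ZMod p) = (c : Fin d → ZMod p) i := fun i => ZMod.coe_valMinAbs _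
  let u : A ⊕ S → ℤ := ∑ i, cc i • w i
  have hu0 : mf ℤ (Matrix.fromBlocks U 0 0 (Matrix.diagonal fun i => p * b i)) u u = 0 := by
    simp only [u, map_sum, LinearMap.sum_apply, map_smul, LinearMap.smul_apply, hww, smul_zero,
      Finset.sum_const_zero]
  have huA : ∀ a, ∃ t : ℤ, u (Sum.inl a) = p * t := by
    intro a
    have h1 : ((u (Sum.inl a) : ℤ) : ZMod p) = 0 := by
      have h2 := congrFun hcker a
      rw [hΦ] at h2
      simp only [u, Finset.sum_apply, Pi.smul_apply, smul_eq_mul, Int.cast_sum, Int.cast_mul, hcc]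
      simpa using h2
    rw [ZMod.intCast_zmod_eq_zero_iff_dvd] at h1
    exact h1
  choose t ht using huA
  have hfu : f j ⬝ᵥ u = cc j := by
    simp only [u, dotProduct_sum, dotProduct_smul, hf]
    simp
  refine ⟨fun s => u (Sum.inr s), ?_, ?_⟩
  · by_contra! hall
    have h1 : ((f j ⬝ᵥ u : ℤ) : ZMod p) = 0 := by
      simp only [dotProduct, Int.cast_sum, Int.cast_mul]
      refine Finset.sum_eq_zero fun k _ => ?_
      rcases k with a | s
      · rw [ht]; simp
      · rw [hall]; simp
    rw [hfu, hcc] at h1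
    exact hj h1
  · rw [mf_blocks, mf_diag] at hu0
    have h1 : (fun a => u (Sum.inl a)) = (p : ℤ) • t := by funext a; simp [ht]
    rw [h1] at hu0
    simp only [map_smul, LinearMap.smul_apply, smul_eq_mul] at hu0
    have h2 : (p : ℤ) * (p * mf ℤ U t t + ∑ i, b i * u (Sum.inr i) ^ 2) = 0 := by
      rw [← hu0, mul_add, Finset.mul_sum]
      congr 1
      exact Finset.sum_congr rfl fun i _ => by
        rw [Int.cast_id]; ring
    have h3 := (mul_eq_zero.1 h2).resolve_left hp0
    have h4 := congrArg (Int.cast : ℤ → ZMod p) h3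
    push_cast at h4
    simpa using h4

end lemP
end SG


namespace SG

open LinearMap (BilinForm)
open Module (finrank)

section descent

/-- Subgroup generated by small symbols. -/
def Sg (m : ℕ) : AddSubgroup WG := AddSubgroup.closure {x | ∃ a : ℤ, Sm m a ∧ x = g a}

theorem Sg_gen {m : ℕ} {a : ℤ} (h : Sm m a) : g a ∈ Sg m :=
  AddSubgroup.subset_closure ⟨a, h, rfl⟩

theorem Sg_mono {m n : ℕ} (h : ∀ a, Sm m a → Sm n a) : Sg m ≤ Sg n := by
  rw [Sg, AddSubgroup.closure_le]
  rintro _ ⟨a, ha, rfl⟩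
  exact Sg_gen (h a ha)

theorem Sg_rep {m : ℕ} {x : WG} (h : x ∈ Sg m) :
    ∃ (k : ℕ) (c : Fin k → ℤ), (∀ i, Sm m (c i)) ∧ x = ∑ i, g (c i) := by
  induction h using AddSubgroup.closure_induction with
  | mem x hx =>
    obtain ⟨a, ha, rfl⟩ := hx
    exact ⟨1, fun _ => a, fun _ => ha, by simp⟩
  | zero => exact ⟨0, Fin.elim0, fun i => i.elim0, by simp⟩
  | add x y _ _ hx hy =>
    obtain ⟨k, c, hc, rfl⟩ := hx
    obtain ⟨l, d, hd, rfl⟩ := hy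
    refine ⟨k + l, Fin.append c d, fun i => ?_, ?_⟩
    · induction i using Fin.addCases with
      | left i => simpa using hc i
      | right i => simpa using hd i
    · rw [Fin.sum_univ_add]; simp
  | neg x _ hx =>
    obtain ⟨k, c, hc, rfl⟩ := hx
    refine ⟨k, fun i => -c i, fun i => (hc i).neg, ?_⟩
    rw [← Finset.sum_neg_distrib]
    exact Finset.sum_congr rfl fun i _ => by rw [Int.cast_neg, g_neg]

theorem GS_quot (p : ℕ) : GS p (fun a : ℤ => QuotientAddGroup.mk' (Sg p) (g a)) where
  sq r s hs := by
    have := g_sq r s (by exact_mod_cast hs)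
    push_cast
    rw [this]
  neg r := by push_cast; rw [g_neg, map_neg]
  add r s hr hs h := by
    have := g_add r s (by exact_mod_cast hr) (by exact_mod_cast hs) (by exact_mod_cast h)
    push_cast
    rw [← map_add, this, map_add]
  sm a ha := (QuotientAddGroup.eq_zero_iff _).2 (Sg_gen ha)

theorem short_of_mem (p : ℕ) [Fact p.Prime] {x : WG} (hx : x ∈ Sg (p + 1)) :
    Short p (fun a : ℤ => QuotientAddGroup.mk' (Sg p) (g a)) (QuotientAddGroup.mk' (Sg p) x) := by
  induction hx using AddSubgroup.closure_induction with
  | mem x hx =>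
    obtain ⟨a, ha, rfl⟩ := hx
    exact (GS_quot p).short_gen ha
  | zero => exact Or.inl (map_zero _)
  | add x y _ _ hx hy => rw [map_add]; exact (GS_quot p).short_add hx hy
  | neg x _ hx => rw [map_neg]; exact (GS_quot p).short_neg hx

variable {A : Type} [Fintype A] [DecidableEq A]

theorem mf_symm' (R : Type*) [CommRing R] {G : Matrix A A ℤ} (hs : G.IsSymm) (x y) :
    mf R G x y = mf R G y x := by
  rw [mf_apply, mf_apply, Matrix.dotProduct_mulVec, ← Matrix.mulVec_transpose, dotProduct_comm,
    ← Matrix.transpose_map, hs]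

theorem mf_nd {F : Type*} [Field F] (U : Matrix A A ℤ) (hU : ((U.det : ℤ) : F) ≠ 0) :
    ND (mf F U) := by
  intro x hx
  have hnd : (mf F U).Nondegenerate := by
    apply LinearMap.nondegenerate_toLinearMap₂'_of_det_ne_zero'
    have : (U.map (Int.cast : ℤ → F)).det = ((U.det : ℤ) : F) := by
      have := (Int.castRingHom F).map_det U
      simp only [RingHom.mapMatrix_apply] at this
      exact this.symm
    rwa [this]
  exact hnd.1 x hx

/-- The rational space of an integral symmetric matrix. -/
noncomputable def NS (G : Matrix A A ℤ) (hs : G.IsSymm) (hG : G.det ≠ 0) : QS :=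
  { V := A → ℚ
    B := mf ℚ G
    sy := mf_symm' ℚ hs
    nd := mf_nd G (by exact_mod_cast hG) }

theorem dq_mf {k : ℕ} (c : Fin k → ℤ) : dq (fun i => (c i : ℚ)) = mf ℚ (Matrix.diagonal c) := by
  refine LinearMap.ext fun x => LinearMap.ext fun y => ?_
  rw [dq_apply, mf_diag]

theorem rep_null {G : Matrix A A ℤ} {hs : G.IsSymm} {hG : G.det ≠ 0} {k : ℕ} (c : Fin k → ℤ)
    (hc : ∀ i, c i ≠ 0) (h : cls (NS G hs hG) = ∑ i, g (c i)) :
    Null (mf ℚ (Matrix.fromBlocks G 0 0 (Matrix.diagonal (-c)))) := by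
  have hc' : ∀ i, (((-c) i : ℤ) : ℚ) ≠ 0 := fun i => by simpa using hc i
  have h0 : cls ((NS G hs hG).plus (dqS _ hc')) = 0 := by
    rw [cls_plus, cls_dq, h, ← Finset.sum_add_distrib]
    refine Finset.sum_eq_zero fun i _ => ?_
    rw [Pi.neg_apply, Int.cast_neg, g_neg, add_neg_cancel]
  have h1 : Null (pf (mf ℚ G) (dq fun i => (((-c) i : ℤ) : ℚ))) := cls_zero_iff.1 h0
  rw [dq_mf] at h1
  exact h1.iso (mf_sum _ _ _).symm

theorem rep_zero (p : ℕ) [hp : Fact p.Prime] {G : Matrix A A ℤ} {hs : G.IsSymm} {hG : G.det ≠ 0}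
    (hu : IsUnit G.det) {k l : ℕ} (c : Fin k → ℤ) (hc : ∀ i, Sm p (c i))
    (b : Fin (l + 1) → ℤ) (hb : ∀ i, Sm p (b i))
    (h : cls (NS G hs hG) = ∑ i, g (c i) + ∑ i, g ((p * b i : ℤ) : ℚ)) :
    ∃ x : Fin (l + 1) → ℤ, (∃ i, (x i : ZMod p) ≠ 0) ∧
      ∑ i, (b i : ZMod p) * (x i : ZMod p) ^ 2 = 0 := by
  have hp0 : (p : ℤ) ≠ 0 := by exact_mod_cast hp.out.ne_zero
  have hc' : ∀ i, (((-c) i : ℤ) : ℚ) ≠ 0 := fun i => by simpa using (hc i).1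
  have hb' : ∀ i, ((p * (-b) i : ℤ) : ℚ) ≠ 0 := fun i => by
    have := mul_ne_zero hp0 (hb i).neg.1
    exact_mod_cast this
  have h0 : cls (((NS G hs hG).plus (dqS _ hc')).plus (dqS _ hb')) = 0 := by
    have e1 : ∑ i, g (((-c) i : ℤ) : ℚ) = -∑ i, g (c i) := by
      rw [← Finset.sum_neg_distrib]
      exact Finset.sum_congr rfl fun i _ => by rw [Pi.neg_apply, Int.cast_neg, g_neg]
    have e2 : ∑ i, g ((p * (-b) i : ℤ) : ℚ) = -∑ i, g ((p * b i : ℤ) : ℚ) := by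
      rw [← Finset.sum_neg_distrib]
      exact Finset.sum_congr rfl fun i _ => by rw [Pi.neg_apply, mul_neg, Int.cast_neg, g_neg]
    rw [cls_plus, cls_plus, cls_dq, cls_dq, h, e1, e2]
    abel
  have h1 : Null (pf (pf (mf ℚ G) (dq fun i => (((-c) i : ℤ) : ℚ)))
      (dq fun i => ((p * (-b) i : ℤ) : ℚ))) := cls_zero_iff.1 h0
  rw [dq_mf, dq_mf] at h1
  have h2 := (h1.iso ((mf_sum ℚ G (Matrix.diagonal (-c))).symm.prod (Isom.refl _))).iso
    (mf_sum ℚ _ _).symm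
  obtain ⟨x, hx, e⟩ := lemma_P p _ (by
    rw [Matrix.det_fromBlocks_zero₂₁, Matrix.det_diagonal]
    rw [Int.cast_mul, Int.cast_prod]
    refine mul_ne_zero ?_ (Finset.prod_ne_zero_iff.2 fun i _ => ?_)
    · rcases Int.isUnit_iff.1 hu with h | h <;> rw [h] <;> simp
    · have := (hc i).neg.not_dvd
      simpa using this) (-b) h2
  refine ⟨x, hx, ?_⟩
  rw [← neg_eq_zero, ← Finset.sum_neg_distrib, ← e]
  exact Finset.sum_congr rfl fun i _ => by simp

theorem descent_prime (p : ℕ) [hp : Fact p.Prime] {G : Matrix A A ℤ} {hs : G.IsSymm}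
    {hG : G.det ≠ 0} (hu : IsUnit G.det) (h : cls (NS G hs hG) ∈ Sg (p + 1)) :
    cls (NS G hs hG) ∈ Sg p := by
  have hcl : ∀ {y}, QuotientAddGroup.mk' (Sg p) (cls (NS G hs hG)) = QuotientAddGroup.mk' (Sg p) y
      → ∃ (k : ℕ) (c : Fin k → ℤ), (∀ i, Sm p (c i)) ∧
        cls (NS G hs hG) = ∑ i, g (c i) + y := by
    intro y hy
    have h1 : cls (NS G hs hG) - y ∈ Sg p := by
      rw [← QuotientAddGroup.eq_zero_iff]
      change QuotientAddGroup.mk' (Sg p) _ = 0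
      rw [map_sub, hy, sub_self]
    obtain ⟨k, c, hc, e⟩ := Sg_rep h1
    exact ⟨k, c, hc, by rw [← e]; abel⟩
  rcases short_of_mem p h with h0 | ⟨x, hx, h0⟩ | ⟨x, y, hx, hy, h0⟩
  · exact (QuotientAddGroup.eq_zero_iff _).1 h0
  · exfalso
    obtain ⟨k, c, hc, e⟩ := hcl (y := g ((p * x.valMinAbs : ℤ) : ℚ)) h0
    obtain ⟨z, ⟨i, hi⟩, e'⟩ := rep_zero p (l := 0) hu c hc (fun _ => x.valMinAbs)
      (fun _ => vma_sm hx) (by simpa using e)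
    have hi0 : i = 0 := by omega
    rw [hi0] at hi
    simp [hx, hi] at e'
  · obtain ⟨k, c, hc, e⟩ := hcl (y := g ((p * x.valMinAbs : ℤ) : ℚ) +
      g ((p * y.valMinAbs : ℤ) : ℚ)) (by rw [map_add]; exact h0)
    obtain ⟨z, ⟨i, hi⟩, e'⟩ := rep_zero p (l := 1) hu c hc ![x.valMinAbs, y.valMinAbs]
      (fun i => by fin_cases i; exacts [vma_sm hx, vma_sm hy])
      (by rw [e]; simp [Fin.sum_univ_two])
    rw [Fin.sum_univ_two] at e'
    have h2 := (GS_quot p).two_zero hx hy (z 0) (z 1) (by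
      fin_cases i
      · exact Or.inl hi
      · exact Or.inr hi) (by simpa using e')
    rw [h2] at h0
    exact (QuotientAddGroup.eq_zero_iff _).1 h0

theorem descent {G : Matrix A A ℤ} {hs : G.IsSymm} {hG : G.det ≠ 0} (hu : IsUnit G.det) (m : ℕ)
    (h : cls (NS G hs hG) ∈ Sg (m + 2)) : cls (NS G hs hG) ∈ Sg 2 := by
  induction m with
  | zero => exact h
  | succ m ih =>
    apply ih
    by_cases hp : (m + 2).Prime
    · have : Fact (m + 2).Prime := ⟨hp⟩
      exact descent_prime (m + 2) hu h
    · refine Sg_mono (fun a ha => ⟨ha.1, fun q hq hd => ?_⟩) h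
      have h1 := ha.2 q hq hd
      have h2 : q ≠ m + 2 := by rintro rfl; exact hp hq
      omega

theorem exists_start (A : QS) : ∃ m : ℕ, cls A ∈ Sg (m + 2) := by
  obtain ⟨k, a, ha, e⟩ := cls_diag A
  have h1 : ∀ i, g (a i) = g (((a i).num * (a i).den : ℤ) : ℚ) := by
    intro i
    have hd : ((a i).den : ℚ) ≠ 0 := by simp
    have h2 : (((a i).num * (a i).den : ℤ) : ℚ) = a i * ((a i).den : ℚ) ^ 2 := by
      push_cast
      rw [pow_two, ← mul_assoc, Rat.mul_den_eq_num]
    rw [h2, g_sq _ _ hd]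
  refine ⟨∑ i, ((a i).num * (a i).den).natAbs, ?_⟩
  rw [e]
  refine AddSubgroup.sum_mem _ fun i _ => ?_
  rw [h1]
  refine Sg_gen (Sm.of_lt (mul_ne_zero (Rat.num_ne_zero.2 (ha i)) (by simp)) ?_)
  have h3 := Finset.single_le_sum (f := fun i => ((a i).num * (a i).den).natAbs)
    (fun _ _ => Nat.zero_le _) (Finset.mem_univ i)
  rw [Int.abs_eq_natAbs]
  omega

theorem sm_two {a : ℤ} (h : Sm 2 a) : a = 1 ∨ a = -1 := by
  have : a.natAbs = 1 := by
    by_contra h1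
    obtain ⟨q, hq, hd⟩ := Nat.exists_prime_and_dvd h1
    have := h.2 q hq (Int.natCast_dvd.2 hd)
    have := hq.two_le
    omega
  omega

theorem end_rep {G : Matrix A A ℤ} {hs : G.IsSymm} {hG : G.det ≠ 0} (hu : IsUnit G.det) :
    ∃ (k : ℕ) (e : ℤ), (e = 1 ∨ e = -1) ∧ cls (NS G hs hG) = ∑ _i : Fin k, g e := by
  obtain ⟨m, hm⟩ := exists_start (NS G hs hG)
  have h2 := descent hu m hm
  have h3 : Sg 2 ≤ AddSubgroup.zmultiples (g 1) := by
    rw [Sg, AddSubgroup.closure_le]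
    rintro _ ⟨a, ha, rfl⟩
    rcases sm_two ha with rfl | rfl
    · simp
    · rw [Int.cast_neg, g_neg]; simp
  obtain ⟨z, hz⟩ := AddSubgroup.mem_zmultiples_iff.1 (h3 h2)
  rcases Int.eq_nat_or_neg z with ⟨k, rfl | rfl⟩
  · refine ⟨k, 1, Or.inl rfl, ?_⟩
    rw [← hz]; simp
  · refine ⟨k, -1, Or.inr rfl, ?_⟩
    rw [← hz, Int.cast_neg, g_neg]; simp

theorem null_base {G : Matrix A A ℤ} (h : Null (mf ℚ G)) : Null (mf ℝ G) := by
  obtain ⟨I, hI, hd⟩ := h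
  obtain ⟨d, hd0⟩ : ∃ d, d = finrank ℚ I := ⟨_, rfl⟩
  obtain ⟨w, f, hw, hf⟩ := sat I d hd0
  rw [Module.finrank_fintype_fun_eq_card, ← hd0] at hd
  have hww : ∀ i j, mf ℝ G (cv ℝ (w i)) (cv ℝ (w j)) = 0 := by
    intro i j
    have := hI _ (hw i) _ (hw j)
    rw [mf_cv] at this ⊢
    exact_mod_cast this
  have hli : LinearIndependent ℝ (fun i => cv ℝ (w i)) := by
    rw [Fintype.linearIndependent_iff]
    intro c hc j
    have h1 := congrArg (fun v => cv ℝ (f j) ⬝ᵥ v) hc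
    simp only [dotProduct_sum, dotProduct_smul, dotProduct_zero] at h1
    have h2 : ∀ i, cv ℝ (f j) ⬝ᵥ cv ℝ (w i) = if i = j then 1 else 0 := by
      intro i
      have := congrArg (Int.cast : ℤ → ℝ) (hf i j)
      simp only [dotProduct] at this ⊢
      push_cast at this
      exact this
    simpa [h2] using h1
  refine ⟨Submodule.span ℝ (Set.range fun i => cv ℝ (w i)), ?_, ?_⟩
  · intro x hx y hy
    rw [Submodule.mem_span_range_iff_exists_fun] at hx hy
    obtain ⟨c, rfl⟩ := hx
    obtain ⟨c', rfl⟩ := hy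
    simp only [map_sum, LinearMap.sum_apply, map_smul, LinearMap.smul_apply, hww, smul_zero,
      Finset.sum_const_zero]
  · rw [finrank_span_eq_card hli, Module.finrank_fintype_fun_eq_card, Fintype.card_fin]
    exact hd

theorem null_rat {G : Matrix A A ℤ} (hs : G.IsSymm) (hu : IsUnit G.det) (hR : Null (mf ℝ G)) :
    Null (mf ℚ G) := by
  have hG : G.det ≠ 0 := hu.ne_zero
  obtain ⟨k, e, he, h⟩ := end_rep (hs := hs) (hG := hG) hu
  have he0 : e ≠ 0 := by rcases he with rfl | rfl <;> norm_num
  have h1 := (null_base (rep_null (fun _ => e) (fun _ => he0) h)).iso (mf_sum ℝ _ _)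
  have h2 := null_cancel (mf_symm' ℝ hs) (mf_nd G (by exact_mod_cast hG))
    (h1.iso (Isom.comm _ _)) hR
  obtain ⟨I, hI, hd⟩ := h2
  have hI0 : I = ⊥ := by
    rw [Submodule.eq_bot_iff]
    intro x hx
    have h3 := hI x hx x hx
    rw [mf_diag] at h3
    have h4 : ∑ i, x i * x i = 0 := by
      have : ∑ i, ((-fun _ : Fin k => e) i : ℝ) * (x i * x i) = (-e : ℝ) * ∑ i, x i * x i := by
        rw [Finset.mul_sum]; simp
      have h5 : (-e : ℝ) * ∑ i, x i * x i = 0 := by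
        rw [← h3, Finset.mul_sum]; simp
      exact (mul_eq_zero.1 h5).resolve_left (by simpa using he0)
    funext i
    have := (Finset.sum_eq_zero_iff_of_nonneg (fun i _ => mul_self_nonneg (x i))).1 h4 i
      (Finset.mem_univ i)
    simpa using this
  rw [hI0, finrank_bot, Module.finrank_fintype_fun_eq_card, Fintype.card_fin] at hd
  have hk : k = 0 := by omega
  subst hk
  have h6 : cls (NS G hs hG) = 0 := by rw [h]; simp
  exact cls_zero_iff.1 h6

end descent
end SG


namespace SG

open LinearMap (BilinForm)
open Module (finrank)

section arith
variable {n : ℕ}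

/-- Solvability of the congruence problem over a ring. -/
def Qr (A B : Matrix (Fin n) (Fin n) ℤ) (R : Type) [CommRing R] : Prop :=
  ∃ T T' : Matrix (Fin n) (Fin n) R, T * T' = 1 ∧
    T.transpose * B.map (Int.cast : ℤ → R) * T = A.map (Int.cast : ℤ → R)

theorem Qr.map {A B : Matrix (Fin n) (Fin n) ℤ} {R S : Type} [CommRing R] [CommRing S]
    (h : Qr A B R) (f : R →+* S) : Qr A B S := by
  obtain ⟨T, T', h1, h2⟩ := h
  have hc : ∀ C : Matrix (Fin n) (Fin n) ℤ,
      (C.map (Int.cast : ℤ → R)).map f = C.map (Int.cast : ℤ → S) := fun C => by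
    ext i j; simp
  refine ⟨T.map f, T'.map f, ?_, ?_⟩
  · rw [← Matrix.map_mul, h1]; simp
  · rw [← hc A, ← hc B, ← h2, Matrix.map_mul, Matrix.map_mul, Matrix.transpose_map]

theorem Qr.prod {A B : Matrix (Fin n) (Fin n) ℤ} {R S : Type} [CommRing R] [CommRing S]
    (h : Qr A B R) (h' : Qr A B S) : Qr A B (R × S) := by
  obtain ⟨T, T', h1, h2⟩ := h
  obtain ⟨U, U', h3, h4⟩ := h'
  have key : ∀ X Y : Matrix (Fin n) (Fin n) (R × S),
      X.map (RingHom.fst R S) = Y.map (RingHom.fst R S) →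
      X.map (RingHom.snd R S) = Y.map (RingHom.snd R S) → X = Y := by
    intro X Y e1 e2
    ext i j
    · exact congrFun (congrFun e1 i) j
    · exact congrFun (congrFun e2 i) j
  have hf : ∀ C : Matrix (Fin n) (Fin n) ℤ, (C.map (Int.cast : ℤ → R × S)).map (RingHom.fst R S)
      = C.map (Int.cast : ℤ → R) := fun C => by ext i j; simp
  have hg : ∀ C : Matrix (Fin n) (Fin n) ℤ, (C.map (Int.cast : ℤ → R × S)).map (RingHom.snd R S)
      = C.map (Int.cast : ℤ → S) := fun C => by ext i j; simp
  have e1 : ∀ (V : Matrix (Fin n) (Fin n) R) (W : Matrix (Fin n) (Fin n) S),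
    (Matrix.of fun i j => (V i j, W i j)).map (RingHom.fst R S) = V := fun V W => by
      ext i j; simp
  have e2 : ∀ (V : Matrix (Fin n) (Fin n) R) (W : Matrix (Fin n) (Fin n) S),
    (Matrix.of fun i j => (V i j, W i j)).map (RingHom.snd R S) = W := fun V W => by
      ext i j; simp
  refine ⟨Matrix.of fun i j => (T i j, U i j), Matrix.of fun i j => (T' i j, U' i j), ?_, ?_⟩
  · apply key
    · rw [Matrix.map_mul, e1, e1, h1]; simp
    · rw [Matrix.map_mul, e2, e2, h3]; simp
  · apply key
    · rw [Matrix.map_mul, Matrix.map_mul, Matrix.transpose_map, e1, hf, hf, h2]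
    · rw [Matrix.map_mul, Matrix.map_mul, Matrix.transpose_map, e2, hg, hg, h4]

theorem Qr.zmod {A B : Matrix (Fin n) (Fin n) ℤ}
    (h : ∀ (p : ℕ) [Fact p.Prime], Qr A B ℤ_[p]) (d : ℕ) : d ≠ 0 → Qr A B (ZMod d) := by
  induction d using Nat.recOnPosPrimePosCoprime with
  | prime_pow p k hp hk =>
    intro _
    have : Fact p.Prime := ⟨hp⟩
    exact (h p).map (PadicInt.toZModPow k)
  | zero => intro h0; exact absurd rfl h0
  | one =>
    intro _
    refine ⟨1, 1, by simp, ?_⟩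
    ext i j
    exact Subsingleton.elim (α := ZMod 1) _ _
  | coprime a b ha hb hab iha ihb =>
    intro _
    exact ((iha (by omega)).prod (ihb (by omega))).map
      (ZMod.chineseRemainder hab).symm.toRingHom

theorem exists_smul {d : ℕ} {X Y : Matrix (Fin n) (Fin n) ℤ}
    (h : X.map (Int.cast : ℤ → ZMod d) = Y.map (Int.cast : ℤ → ZMod d)) :
    ∃ Z, X = Y + (d : ℤ) • Z := by
  have h1 : ∀ i j, ∃ z, X i j - Y i j = d * z := by
    intro i j
    have h2 : (X i j : ZMod d) = Y i j := congrFun (congrFun h i) j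
    have h3 : ((X i j - Y i j : ℤ) : ZMod d) = 0 := by push_cast; rw [h2, sub_self]
    rw [ZMod.intCast_zmod_eq_zero_iff_dvd] at h3
    exact h3
  choose z hz using h1
  refine ⟨Matrix.of z, ?_⟩
  ext i j
  have := hz i j
  simp only [Matrix.add_apply, Matrix.smul_apply, Matrix.of_apply, smul_eq_mul]
  linarith

theorem Qr.lift {A B : Matrix (Fin n) (Fin n) ℤ} {d : ℕ} (h : Qr A B (ZMod d)) :
    ∃ T T' X E : Matrix (Fin n) (Fin n) ℤ, T.transpose * B * T = A + (d : ℤ) • X ∧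
      T * T' = 1 + (d : ℤ) • E := by
  obtain ⟨T, T', h1, h2⟩ := h
  have hm : ∀ U V : Matrix (Fin n) (Fin n) ℤ, (U * V).map (Int.cast : ℤ → ZMod d) =
    U.map (Int.cast : ℤ → ZMod d) * V.map (Int.cast : ℤ → ZMod d) := fun U V =>
      Matrix.map_mul (f := Int.castRingHom (ZMod d))
  have hl : ∀ U : Matrix (Fin n) (Fin n) (ZMod d),
      (U.map (fun x => x.cast)).map (Int.cast : ℤ → ZMod d) = U := fun U => by
    ext i j; simp
  obtain ⟨X, hX⟩ := exists_smul (d := d)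
    (X := (T.map (fun x => (x.cast : ℤ))).transpose * B * T.map (fun x => x.cast)) (Y := A) (by
      rw [hm, hm, ← Matrix.transpose_map, hl, hl, h2])
  obtain ⟨E, hE⟩ := exists_smul (d := d)
    (X := T.map (fun x => (x.cast : ℤ)) * T'.map (fun x => x.cast)) (Y := 1) (by
      rw [hm, hl, hl, h1]; simp)
  exact ⟨_, _, X, E, hX, hE⟩

theorem arith {A B T T' X E : Matrix (Fin n) (Fin n) ℤ} (hA : A.IsSymm) (hB : B.IsSymm)
    (hA0 : A.det ≠ 0) (hB0 : B.det ≠ 0)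
    (hX : T.transpose * B * T = A + (2 * (A.det * B.det) ^ 2) • X)
    (hE : T * T' = 1 + (2 * (A.det * B.det) ^ 2) • E) :
    ∃ C P W : Matrix (Fin n) (Fin n) ℤ, C.IsSymm ∧ (∀ i, 2 ∣ C i i) ∧ P * A = B * T ∧
      P.transpose * T = 1 + C * A ∧ P * T.transpose = 1 + B * W := by
  have hAt : A.transpose = A := hA
  have hBt : B.transpose = B := hB
  have hadjt : A.adjugate.transpose = A.adjugate := by rw [Matrix.adjugate_transpose, hAt]
  have hd0 : (2 * (A.det * B.det) ^ 2 : ℤ) ≠ 0 := by positivity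
  have hXs : X.transpose = X := by
    have h1 := congrArg Matrix.transpose hX
    rw [Matrix.transpose_mul, Matrix.transpose_mul, Matrix.transpose_transpose, hBt,
      Matrix.transpose_add, Matrix.transpose_smul, hAt, ← Matrix.mul_assoc, hX] at h1
    have h2 := add_left_cancel h1
    exact (smul_right_injective _ hd0 h2).symm
  set a := A.det with ha
  set b := B.det with hb
  have hAA : A * A.adjugate = a • 1 := Matrix.mul_adjugate A
  have hAA' : A.adjugate * A = a • 1 := Matrix.adjugate_mul A
  have hEt : T'.transpose * T.transpose = 1 + (2 * (a * b) ^ 2) • E.transpose := by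
    rw [← Matrix.transpose_mul, hE, Matrix.transpose_add, Matrix.transpose_one,
      Matrix.transpose_smul]
  let Y := T'.transpose * X - E.transpose * B * T
  have hY : B * T = T'.transpose * A + (2 * (a * b) ^ 2) • Y := by
    have h1 := congrArg (fun M => T'.transpose * M) hX
    simp only [← Matrix.mul_assoc, hEt, Matrix.mul_add, Matrix.add_mul, Matrix.one_mul,
      Matrix.smul_mul, Matrix.mul_smul] at h1
    simp only [Y, smul_sub]
    rw [← add_sub_assoc, ← h1]
    abel
  let C := (2 * b ^ 2) • (A.adjugate * X * A.adjugate)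
  let P := T'.transpose + (2 * a * b ^ 2) • (Y * A.adjugate)
  have hPA : P * A = B * T := by
    rw [hY]
    simp only [P, Matrix.add_mul, Matrix.smul_mul, Matrix.mul_assoc, hAA', Matrix.mul_smul,
      Matrix.mul_one, smul_smul]
    congr 2
    ring
  have hCt : C.transpose = C := by
    simp only [C, Matrix.transpose_smul, Matrix.transpose_mul, hadjt, hXs, Matrix.mul_assoc]
  refine ⟨C, P, B.adjugate * ((2 * a ^ 2 * b) • E.transpose +
    (2 * a * b) • (Y * A.adjugate * T.transpose)), hCt, ?_, hPA, ?_, ?_⟩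
  · intro i
    refine ⟨b ^ 2 * (A.adjugate * X * A.adjugate) i i, ?_⟩
    simp only [C, Matrix.smul_apply, smul_eq_mul]; ring
  · have h1 : A * (P.transpose * T) = A * (1 + C * A) := by
      have h2 : A * P.transpose = T.transpose * B := by
        have := congrArg Matrix.transpose hPA
        rwa [Matrix.transpose_mul, Matrix.transpose_mul, hAt, hBt] at this
      rw [← Matrix.mul_assoc, h2, hX]
      simp only [C, Matrix.mul_add, Matrix.mul_one, Matrix.smul_mul, Matrix.mul_smul,
        Matrix.mul_assoc, hAA', smul_smul]
      rw [← Matrix.mul_assoc, hAA, Matrix.smul_mul, Matrix.one_mul, smul_smul]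
      congr 2
      ring
    have h3 := congrArg (fun M => A.adjugate * M) h1
    simp only [← Matrix.mul_assoc, hAA', Matrix.smul_mul, Matrix.one_mul] at h3
    simpa only [Matrix.mul_assoc] using smul_right_injective _ hA0 (by simpa using h3)
  · have hBB : B * B.adjugate = b • 1 := Matrix.mul_adjugate B
    rw [← Matrix.mul_assoc, hBB]
    simp only [P, Matrix.add_mul, hEt, Matrix.smul_mul, Matrix.one_mul, smul_add, smul_smul]
    rw [add_assoc]
    congr 3 <;> ring_nf

end arith
end SG


namespace SG

open LinearMap (BilinForm)
open Module (finrank)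

section final

theorem cv_li {F : Type*} [Field F] {κ : Type} [Fintype κ] {d : ℕ} (w f : Fin d → κ → ℤ)
    (hf : ∀ i j, f j ⬝ᵥ w i = if i = j then 1 else 0) :
    LinearIndependent F (fun i => cv F (w i)) := by
  rw [Fintype.linearIndependent_iff]
  intro c hc j
  have h1 := congrArg (fun v => cv F (f j) ⬝ᵥ v) hc
  simp only [dotProduct_sum, dotProduct_smul, dotProduct_zero] at h1
  have h2 : ∀ i, cv F (f j) ⬝ᵥ cv F (w i) = if i = j then 1 else 0 := by
    intro i
    have := congrArg (Int.cast : ℤ → F) (hf i j)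
    simp only [dotProduct] at this ⊢
    push_cast at this
    exact this
  simpa [h2] using h1

theorem even_of_split {κ : Type} [Fintype κ] [DecidableEq κ] {G K : Matrix κ κ ℤ}
    (h : K + K.transpose = G) : EvenForm (mf ℤ G) := by
  intro x
  refine ⟨x ⬝ᵥ K.mulVec x, ?_⟩
  have : G.map (Int.cast : ℤ → ℤ) = K + K.transpose := by rw [h]; ext i j; simp
  rw [mf_apply, this, Matrix.add_mulVec, dotProduct_add, Matrix.dotProduct_mulVec x K.transpose,
    ← Matrix.mulVec_transpose, Matrix.transpose_transpose, dotProduct_comm (K.mulVec x)]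
  ring

theorem mf_int {κ : Type} [Fintype κ] [DecidableEq κ] (G : Matrix κ κ ℤ) (x y : κ → ℤ) :
    mf ℤ G x y = x ⬝ᵥ G.mulVec y := by
  have : G.map (Int.cast : ℤ → ℤ) = G := by ext i j; simp
  rw [mf_apply, this]

theorem null_hyp {κ : Type} [Fintype κ] [DecidableEq κ] {n : ℕ} {G : Matrix κ κ ℤ}
    (hκ : Fintype.card κ = 2 * n) (hs : G.IsSymm) (hu : IsUnit G.det) (hev : EvenForm (mf ℤ G))
    (hN : Null (mf ℚ G)) : Isom (hypn n) (mf ℤ G) := by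
  obtain ⟨I, hI, hd⟩ := hN
  have hG : ((G.det : ℤ) : ℚ) ≠ 0 := by exact_mod_cast hu.ne_zero
  have hr := isotropic_rank G hG I hI
  rw [Module.finrank_fintype_fun_eq_card] at hd
  have hn : n = finrank ℚ I := by omega
  obtain ⟨w, f, hw, hf⟩ := sat I n hn
  have hww : ∀ i j, mf ℤ G (w i) (w j) = 0 := by
    intro i j
    have := hI _ (hw i) _ (hw j)
    rw [mf_cv] at this
    exact_mod_cast this
  let i : (Fin n → ℤ) →ₗ[ℤ] (κ → ℤ) := Fintype.linearCombination ℤ w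
  have hi : ∀ a, i a = ∑ k, a k • w k := fun a => Fintype.linearCombination_apply _ _ _
  let gg : (Fin n → ℤ) →ₗ[ℤ] (κ → ℤ) := Fintype.linearCombination ℤ fun j => G⁻¹.mulVec (f j)
  have hgg : ∀ a, gg a = ∑ k, a k • G⁻¹.mulVec (f k) :=
    fun a => Fintype.linearCombination_apply _ _ _
  have hwg : ∀ k l, mf ℤ G (w k) (G⁻¹.mulVec (f l)) = if k = l then 1 else 0 := by
    intro k l
    rw [mf_int, Matrix.mulVec_mulVec, Matrix.mul_nonsing_inv _ hu, Matrix.one_mulVec,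
      dotProduct_comm, hf]
  have h0 : Isom (pf (0 : BilinForm ℤ PUnit) (hypn n)) (mf ℤ G) := by
    refine split_isotropic (mf_symm' ℤ hs) hev (fun _ _ => rfl) i gg 0 ?_ ?_ ?_ ?_ ?_
    · intro a b
      rw [hi, hi]
      simp only [map_sum, LinearMap.sum_apply, map_smul, LinearMap.smul_apply, hww, smul_zero,
        Finset.sum_const_zero]
    · intro a b
      rw [hi, hgg]
      simp only [map_sum, LinearMap.sum_apply, map_smul, LinearMap.smul_apply, hwg]
      simp [dotProduct, mul_comm]
    · intro x a; simp
    · intro x y; simp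
    · intro z hz
      have hli := cv_li (F := ℚ) w f hf
      let W := Submodule.span ℚ (Set.range fun k => cv ℚ (w k))
      have hWr : finrank ℚ W = n := by
        rw [finrank_span_eq_card hli, Fintype.card_fin]
      have hnd : (mf ℚ G).Nondegenerate := by
        apply LinearMap.nondegenerate_toLinearMap₂'_of_det_ne_zero'
        have : (G.map (Int.cast : ℤ → ℚ)).det = ((G.det : ℤ) : ℚ) := by
          have := (Int.castRingHom ℚ).map_det G
          simp only [RingHom.mapMatrix_apply] at this
          exact this.symm
        rwa [this]
      have hmem : ∀ z : κ → ℤ, (∀ k, mf ℤ G (w k) z = 0) →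
          cv ℚ z ∈ (mf ℚ G).orthogonal W := by
        intro z hz
        rw [LinearMap.BilinForm.mem_orthogonal_iff]
        intro y hy
        rw [Submodule.mem_span_range_iff_exists_fun] at hy
        obtain ⟨c, rfl⟩ := hy
        change mf ℚ G _ _ = 0
        simp [map_sum, LinearMap.sum_apply, mf_cv, hz]
      have hle : W ≤ (mf ℚ G).orthogonal W := by
        rw [Submodule.span_le]
        rintro _ ⟨k, rfl⟩
        exact hmem _ fun l => hww l k
      have hfo := LinearMap.BilinForm.finrank_orthogonal hnd W
      rw [hWr, Module.finrank_fintype_fun_eq_card] at hfo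
      have heq : W = (mf ℚ G).orthogonal W :=
        Submodule.eq_of_le_of_finrank_le hle (by rw [hfo, hWr]; omega)
      have hzW : cv ℚ z ∈ W := by
        rw [heq]
        refine hmem z fun k => ?_
        have := hz (Pi.single k 1)
        rw [hi] at this
        rw [mf_symm' ℤ hs]
        simpa [Pi.single_apply] using this
      rw [Submodule.mem_span_range_iff_exists_fun] at hzW
      obtain ⟨c, hc⟩ := hzW
      have hcj : ∀ j, c j = ((f j ⬝ᵥ z : ℤ) : ℚ) := by
        intro j
        have h1 := congrArg (fun v => cv ℚ (f j) ⬝ᵥ v) hc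
        simp only [dotProduct_sum, dotProduct_smul] at h1
        have h2 : ∀ u, cv ℚ (f j) ⬝ᵥ cv ℚ u = ((f j ⬝ᵥ u : ℤ) : ℚ) := by
          intro u
          simp only [dotProduct, cv]
          push_cast
          rfl
        simp only [h2, hf] at h1
        simpa using h1
      refine ⟨0, fun j => f j ⬝ᵥ z, ?_⟩
      rw [map_zero, zero_add, hi]
      funext t
      have h3 := congrFun hc t
      simp only [hcj, Finset.sum_apply, Pi.smul_apply, smul_eq_mul, cv] at h3 ⊢
      exact_mod_cast h3.symm
  refine Isom.trans ?_ h0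
  exact ⟨LinearEquiv.ofLinearMap (LinearMap.inr ℤ PUnit _) (LinearMap.snd ℤ PUnit _) rfl rfl,
    fun x y => by
      change 0 + hypn n x y = hypn n x y
      rw [zero_add]⟩

variable {n : ℕ}

theorem glue_isom {A B T C P K : Matrix (Fin n) (Fin n) ℤ} (hA : A.IsSymm)
    (hB0 : B.det ≠ 0)
    (hs : (Matrix.fromBlocks C P.transpose P B).IsSymm)
    (hev : EvenForm (mf ℤ (Matrix.fromBlocks C P.transpose P B)))
    (hK : K + K.transpose = A)
    (h1 : P * A = B * T) (h2 : P.transpose * T = 1 + C * A) :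
    Isom (pf (mf ℤ B) (hypn n)) (pf (mf ℤ (Matrix.fromBlocks C P.transpose P B)) (mf ℤ A)) := by
  set G := Matrix.fromBlocks C P.transpose P B with hGdef
  have hAt : A.transpose = A := hA
  have hsymA : ∀ x y, x ⬝ᵥ A.mulVec y = A.mulVec x ⬝ᵥ y := fun x y => by
    rw [Matrix.dotProduct_mulVec, ← Matrix.mulVec_transpose, hAt]
  have hsy : ∀ x y, pf (mf ℤ G) (mf ℤ A) x y = pf (mf ℤ G) (mf ℤ A) y x := fun x y => by
    rw [pf_apply, pf_apply, mf_symm' ℤ hs, mf_symm' ℤ hA]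
  let i : (Fin n → ℤ) →ₗ[ℤ] ((Fin n ⊕ Fin n → ℤ) × (Fin n → ℤ)) :=
    (Matrix.mulVecLin (Matrix.fromRows A (-T))).prod LinearMap.id
  let g : (Fin n → ℤ) →ₗ[ℤ] ((Fin n ⊕ Fin n → ℤ) × (Fin n → ℤ)) :=
    (Matrix.mulVecLin (Matrix.fromRows (-1) 0)).prod 0
  let s : (Fin n → ℤ) →ₗ[ℤ] ((Fin n ⊕ Fin n → ℤ) × (Fin n → ℤ)) :=
    (Matrix.mulVecLin (Matrix.fromRows 0 1)).prod 0
  have hi : ∀ a, i a = (Sum.elim (A.mulVec a) (-T.mulVec a), a) := fun a => by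
    simp [i, Matrix.fromRows_mulVec, Matrix.neg_mulVec]
  have hg : ∀ a, g a = (Sum.elim (-a) 0, 0) := fun a => by
    simp [g, Matrix.fromRows_mulVec, Matrix.neg_mulVec]
  have hss : ∀ a, s a = (Sum.elim (0 : Fin n → ℤ) a, 0) := fun a => by
    simp [s, Matrix.fromRows_mulVec]
  have hGi : ∀ a, G.mulVec (Sum.elim (A.mulVec a) (-T.mulVec a)) = Sum.elim (-a) 0 := by
    intro a
    rw [hGdef, Matrix.fromBlocks_mulVec]
    congr 1
    · simp only [Sum.elim_comp_inl, Sum.elim_comp_inr, Matrix.mulVec_neg, Matrix.mulVec_mulVec,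
        h2, Matrix.add_mulVec, Matrix.one_mulVec]
      abel
    · simp only [Sum.elim_comp_inl, Sum.elim_comp_inr, Matrix.mulVec_neg, Matrix.mulVec_mulVec,
        h1]
      abel
  have key : ∀ x l a, pf (mf ℤ G) (mf ℤ A) (x, l) (i a) =
      A.mulVec l ⬝ᵥ a - (x ∘ Sum.inl) ⬝ᵥ a := by
    intro x l a
    rw [hi, pf_apply, mf_int, mf_int, hGi, hsymA]
    have : x ⬝ᵥ Sum.elim (-a) 0 = -((x ∘ Sum.inl) ⬝ᵥ a) := by
      simp [dotProduct, Fintype.sum_sum_type]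
    rw [this]; ring
  have hevF : EvenForm (pf (mf ℤ G) (mf ℤ A)) := by
    rintro ⟨x, l⟩
    obtain ⟨c, hc⟩ := hev x
    obtain ⟨c', hc'⟩ := even_of_split hK l
    exact ⟨c + c', by rw [pf_apply, hc, hc']; ring⟩
  refine split_isotropic hsy hevF ?_ i g s ?_ ?_ ?_ ?_ ?_
  · intro x hx
    have : Matrix.vecMul x B = 0 := by
      funext j
      have := hx (Pi.single j 1)
      rw [mf_int, Matrix.dotProduct_mulVec] at this
      simpa using this
    exact Matrix.eq_zero_of_vecMul_eq_zero hB0 this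
  · intro a b
    rw [hi a, key]
    simp
  · intro a b
    rw [hsy, hg, key]
    simp [dotProduct_comm]
  · intro x a
    rw [hss, key]
    simp
  · intro x y
    rw [hss, hss, pf_apply, mf_int, mf_int, hGdef, Matrix.fromBlocks_mulVec,
      mf_int B]
    simp [dotProduct, Fintype.sum_sum_type]
  · rintro ⟨x, l⟩ hz
    have hxl : A.mulVec l = x ∘ Sum.inl := by
      funext j
      have := hz (Pi.single j 1)
      rw [key] at this
      simp only [dotProduct_single, mul_one] at this
      linarith
    refine ⟨x ∘ Sum.inr + T.mulVec l, l, ?_⟩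
    rw [hss, hi, hxl]
    refine Prod.ext ?_ ?_
    · funext t
      rcases t with t | t <;> simp
    · simp

theorem glue_det {A B T C P W : Matrix (Fin n) (Fin n) ℤ}
    (h1 : P * A = B * T) (h2 : P.transpose * T = 1 + C * A)
    (h3 : P * T.transpose = 1 + B * W) :
    IsUnit (Matrix.fromBlocks C P.transpose P B).det := by
  obtain ⟨Q, hQ⟩ : ∃ Q, Q = C * T.transpose - P.transpose * W := ⟨_, rfl⟩
  refine Matrix.isUnit_det_of_right_inverse
    (B := Matrix.fromBlocks (-A) (T.transpose + A * Q) T (-W - T * Q)) ?_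
  rw [Matrix.fromBlocks_multiply, ← Matrix.fromBlocks_one]
  congr 1
  · rw [h2, Matrix.mul_neg]; abel
  · rw [Matrix.mul_add, Matrix.mul_sub, Matrix.mul_neg, ← Matrix.mul_assoc, ← Matrix.mul_assoc P.transpose T,
      h2, Matrix.add_mul, Matrix.one_mul]
    rw [hQ]
    abel
  · rw [Matrix.mul_neg, h1]; abel
  · rw [Matrix.mul_add, Matrix.mul_sub, Matrix.mul_neg, ← Matrix.mul_assoc, ← Matrix.mul_assoc B T,
      h1, h3]
    abel

theorem glue_null {A B T C P : Matrix (Fin n) (Fin n) ℤ} (hA : A.IsSymm) (hB : B.IsSymm)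
    (hA0 : A.det ≠ 0)
    (h1 : P * A = B * T) (h2 : P.transpose * T = 1 + C * A)
    (E : Matrix (Fin n) (Fin n) ℝ)
    (hE : E.transpose * B.map (Int.cast : ℤ → ℝ) * E = A.map (Int.cast : ℤ → ℝ)) :
    Null (mf ℝ (Matrix.fromBlocks C P.transpose P B)) := by
  have hm : ∀ U V : Matrix (Fin n) (Fin n) ℤ, (U * V).map (Int.cast : ℤ → ℝ) =
    U.map (Int.cast : ℤ → ℝ) * V.map (Int.cast : ℤ → ℝ) := fun U V =>
      Matrix.map_mul (f := Int.castRingHom ℝ)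
  have h1' := congrArg (fun M => M.map (Int.cast : ℤ → ℝ)) h1
  have h2' := congrArg (fun M => M.map (Int.cast : ℤ → ℝ)) h2
  simp only [hm, Matrix.transpose_map] at h1' h2'
  rw [Matrix.map_add _ (by simp), hm, Matrix.map_one _ (by simp) (by simp)] at h2'
  have hAt : (A.map (Int.cast : ℤ → ℝ)).transpose = A.map (Int.cast : ℤ → ℝ) := by
    rw [← Matrix.transpose_map, hA]
  have hBt : (B.map (Int.cast : ℤ → ℝ)).transpose = B.map (Int.cast : ℤ → ℝ) := by
    rw [← Matrix.transpose_map, hB]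
  have hdet : (A.map (Int.cast : ℤ → ℝ)).det ≠ 0 := by
    have := (Int.castRingHom ℝ).map_det A
    simp only [RingHom.mapMatrix_apply] at this
    have h4 : (A.map (Int.cast : ℤ → ℝ)).det = ((A.det : ℤ) : ℝ) := this.symm
    rw [h4]; exact_mod_cast hA0
  have hG : (Matrix.fromBlocks C P.transpose P B).map (Int.cast : ℤ → ℝ) =
      Matrix.fromBlocks (C.map Int.cast) (P.map Int.cast).transpose (P.map Int.cast)
        (B.map Int.cast) := by
    rw [Matrix.fromBlocks_map, Matrix.transpose_map]
  generalize A.map (Int.cast : ℤ → ℝ) = a at *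
  generalize B.map (Int.cast : ℤ → ℝ) = b at *
  generalize C.map (Int.cast : ℤ → ℝ) = c at *
  generalize P.map (Int.cast : ℤ → ℝ) = p at *
  generalize T.map (Int.cast : ℤ → ℝ) = t at *
  have h3 : a * p.transpose = t.transpose * b := by
    have := congrArg Matrix.transpose h1'
    rwa [Matrix.transpose_mul, Matrix.transpose_mul, hAt, hBt] at this
  have hinj : Function.Injective (Matrix.mulVecLin (Matrix.fromRows a (E - t))) := by
    rw [injective_iff_map_eq_zero]
    intro x hx
    rw [Matrix.mulVecLin_apply, Matrix.fromRows_mulVec] at hx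
    have h5 : a.mulVec x = 0 := by
      funext j
      exact congrFun hx (Sum.inl j)
    exact Matrix.eq_zero_of_mulVec_eq_zero hdet h5
  refine ⟨LinearMap.range (Matrix.mulVecLin (Matrix.fromRows a (E - t))), ?_, ?_⟩
  · rintro _ ⟨x, rfl⟩ _ ⟨y, rfl⟩
    have hz : a * (c * a + p.transpose * (E - t)) +
        (E - t).transpose * (p * a + b * (E - t)) = 0 := by
      have e1 : c * a + p.transpose * (E - t) = p.transpose * E - 1 := by
        rw [Matrix.mul_sub, h2']; abel
      have e2 : p * a + b * (E - t) = b * E := by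
        rw [Matrix.mul_sub, h1']; abel
      rw [e1, e2, Matrix.mul_sub, ← Matrix.mul_assoc, h3, Matrix.transpose_sub, Matrix.sub_mul,
        ← Matrix.mul_assoc E.transpose, hE, Matrix.mul_one, Matrix.mul_assoc]
      abel
    rw [mf_apply, hG, Matrix.mulVecLin_apply, Matrix.mulVecLin_apply, Matrix.fromRows_mulVec,
      Matrix.fromRows_mulVec, Matrix.fromBlocks_mulVec]
    simp only [Sum.elim_comp_inl, Sum.elim_comp_inr, Matrix.mulVec_mulVec, ← Matrix.add_mulVec]
    have h6 : ∀ u v u' v' : Fin n → ℝ, Sum.elim u v ⬝ᵥ Sum.elim u' v' = u ⬝ᵥ u' + v ⬝ᵥ v' := by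
      intro u v u' v'
      simp [dotProduct, Fintype.sum_sum_type]
    rw [h6]
    have h7 : ∀ (M : Matrix (Fin n) (Fin n) ℝ) (z : Fin n → ℝ),
        M.mulVec x ⬝ᵥ z = x ⬝ᵥ M.transpose.mulVec z := by
      intro M z
      rw [Matrix.dotProduct_mulVec, Matrix.vecMul_transpose]
    rw [h7, h7, hAt, Matrix.mulVec_mulVec, Matrix.mulVec_mulVec, ← dotProduct_add,
      ← Matrix.add_mulVec, hz]
    simp
  · rw [LinearMap.finrank_range_of_inj hinj, Module.finrank_fintype_fun_eq_card,
      Module.finrank_fintype_fun_eq_card, Fintype.card_sum, Fintype.card_fin]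
    omega

theorem stable_mat {A B : Matrix (Fin n) (Fin n) ℤ} (hA : A.IsSymm) (hB : B.IsSymm)
    (hA2 : ∀ i, 2 ∣ A i i) (hB2 : ∀ i, 2 ∣ B i i) (hA0 : A.det ≠ 0) (hB0 : B.det ≠ 0)
    (hp : ∀ (p : ℕ) [Fact p.Prime], Isom (mf ℤ_[p] A) (mf ℤ_[p] B))
    (hR : Isom (mf ℝ A) (mf ℝ B)) : Isom (pf (mf ℤ A) (hyp ℤ)) (pf (mf ℤ B) (hyp ℤ)) := by
  rcases n with _ | n
  · rw [Subsingleton.elim A B]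
    exact Isom.refl _
  have hq : ∀ (p : ℕ) [Fact p.Prime], Qr A B ℤ_[p] := by
    intro p _
    obtain ⟨E, E', h1, _, h2⟩ := (isom_iff_mat _ _ _).1 (hp p)
    exact ⟨E, E', h1, h2⟩
  have hd : ((2 * (A.det * B.det) ^ 2).natAbs : ℤ) = 2 * (A.det * B.det) ^ 2 :=
    Int.natAbs_of_nonneg (by positivity)
  obtain ⟨T, T', X, E, hX, hE⟩ := (Qr.zmod hq (2 * (A.det * B.det) ^ 2).natAbs (by
    rw [Int.natAbs_ne_zero]; positivity)).lift
  rw [hd] at hX hE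
  obtain ⟨C, P, W, hC, hC2, h1, h2, h3⟩ := arith hA hB hA0 hB0 hX hE
  obtain ⟨KA, hKA⟩ := even_split_mat A hA hA2
  obtain ⟨KB, hKB⟩ := even_split_mat B hB hB2
  obtain ⟨KC, hKC⟩ := even_split_mat C hC hC2
  have hs : (Matrix.fromBlocks C P.transpose P B).IsSymm :=
    Matrix.IsSymm.fromBlocks hC (by simp) hB
  have hev : EvenForm (mf ℤ (Matrix.fromBlocks C P.transpose P B)) :=
    even_of_split (K := Matrix.fromBlocks KC 0 P KB) (by
      rw [Matrix.fromBlocks_transpose, Matrix.fromBlocks_add, hKC, hKB]; simp)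
  have hu := glue_det h1 h2 h3
  obtain ⟨E₀, _, _, _, hE₀⟩ := (isom_iff_mat _ _ _).1 hR
  have hnull := null_rat hs hu (glue_null hA hB hA0 h1 h2 E₀ hE₀)
  have hN := null_hyp (n := n + 1) (by simp; omega) hs hu hev hnull
  have hM := glue_isom hA hB0 hs hev hKA h1 h2
  refine cancel_hypn (mf_symm' ℤ hB) (even_of_split hKB) n ?_
  exact ((Isom.comm _ _).trans (hN.prod (Isom.refl _))).trans hM.symm

theorem stable_of_genus (L M : EvenLattice) (h : SameGenus L M) :
    IsometricOver ℤ (dsum L hyperbolicPlane) (dsum M hyperbolicPlane) := by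
  rw [stab_iff]
  obtain ⟨h1, h2⟩ := h
  rw [isometricOver_iff] at h2
  have h3 : ∀ (p : ℕ) [Fact p.Prime], Isom (mf ℤ_[p] L.B) (mf ℤ_[p] M.B) := fun p _ =>
    (isometricOver_iff _ _ _).1 (h1 p)
  clear h1
  obtain ⟨n, A, hA, hA2, hA0⟩ := L
  obtain ⟨m, B, hB, hB2, hB0⟩ := M
  simp only at h2 h3 ⊢
  have hnm : n = m := by
    obtain ⟨e, _⟩ := h2
    have := e.finrank_eq
    simpa using this
  subst hnm
  exact stable_mat hA hB hA2 hB2 hA0 hB0 h3 h2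

end final
end SG

/-- **Genus and stable equivalence.** Two even lattices lie in the same genus if and only if
they become isometric after adding a hyperbolic plane `II_{1,1}`. -/
theorem same_genus_iff_stably_isometric (L M : EvenLattice) :
    SameGenus L M ↔ IsometricOver ℤ (dsum L hyperbolicPlane) (dsum M hyperbolicPlane) := by
  exact ⟨SG.stable_of_genus L M, SG.genus_of_stable L M⟩
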